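/- arXiv:2207.14608 — 3 statements merged into one kernel-verified Lean document; each statement's English description precedes it below -/
import Mathlib

section
/- For every n ≥ 0 and every object [i,j] of Σⁿ, the comma category ιⁿ/[i,j] of the full inclusion ιⁿ : Λⁿ ⥤ Σⁿ over [i,j] (its objects are the intervals of length at most 1 contained in [i,j]) is equivalent to the category Λ^{j−i}; in particular every such comma category is connected, and hence the inclusion ιⁿ : Λⁿ ⥤ Σⁿ is an initial functor, i.e. for every functor G : Σⁿ ⥤ Set the canonical map lim_{Σⁿ} G → lim_{Λⁿ} (G ∘ ιⁿ) is a bijection. -/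
open CategoryTheory Simplicial Opposite

namespace Paper

/-- The poset `Σⁿ` of intervals `[i,j]`, `0 ≤ i ≤ j ≤ n`, ordered by inclusion of
intervals: there is a (unique) morphism `[i,j] ⟶ [i',j']` exactly when `i' ≤ i ≤ j ≤ j'`. -/
def IntervalPoset (n : ℕ) : Type :=
  {p : Fin (n + 1) × Fin (n + 1) // p.1 ≤ p.2}

instance (n : ℕ) : Preorder (IntervalPoset n) where
  le a b := b.1.1 ≤ a.1.1 ∧ a.1.2 ≤ b.1.2
  le_refl a := ⟨le_refl _, le_refl _⟩
  le_trans a b c hab hbc := ⟨hbc.1.trans hab.1, hab.2.trans hbc.2⟩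

/-- The length `j - i` of an interval `[i,j]`. -/
def IntervalPoset.length {n : ℕ} (p : IntervalPoset n) : ℕ :=
  (p.1.2 : ℕ) - (p.1.1 : ℕ)

/-- The full subcategory `Λⁿ ⊆ Σⁿ` on the intervals of length at most `1`. -/
def LambdaCat (n : ℕ) : Type :=
  ObjectProperty.FullSubcategory (fun p : IntervalPoset n => p.length ≤ 1)

instance (n : ℕ) : Category (LambdaCat n) :=
  ObjectProperty.FullSubcategory.category _

/-- The full inclusion `ιⁿ : Λⁿ ⥤ Σⁿ`. -/
def lambdaIncl (n : ℕ) : LambdaCat n ⥤ IntervalPoset n :=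
  ObjectProperty.ι _

end Paper

namespace Paper

open CategoryTheory.Limits

/-- Constructor for objects of `Λⁿ` from natural numbers. -/
def LambdaCat.mk {n : ℕ} (a b : ℕ) (hab : a ≤ b) (hb : b ≤ n) (h : b - a ≤ 1) : LambdaCat n :=
  ⟨⟨(⟨a, by omega⟩, ⟨b, by omega⟩), hab⟩, h⟩

/-- Left endpoint. -/
def LambdaCat.lo {n : ℕ} (X : LambdaCat n) : ℕ := X.obj.1.1

/-- Right endpoint. -/
def LambdaCat.hi {n : ℕ} (X : LambdaCat n) : ℕ := X.obj.1.2

lemma LambdaCat.lo_le_hi {n : ℕ} (X : LambdaCat n) : X.lo ≤ X.hi := X.obj.2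

lemma LambdaCat.hi_le {n : ℕ} (X : LambdaCat n) : X.hi ≤ n := Nat.le_of_lt_succ X.obj.1.2.2

lemma LambdaCat.len_le {n : ℕ} (X : LambdaCat n) : X.hi - X.lo ≤ 1 := X.property

/-- Morphisms in `Λⁿ` from inequalities. -/
def LambdaCat.hom {n : ℕ} {X Y : LambdaCat n} (h₁ : Y.lo ≤ X.lo) (h₂ : X.hi ≤ Y.hi) : X ⟶ Y :=
  ObjectProperty.homMk (homOfLE ⟨h₁, h₂⟩)

lemma LambdaCat.le_of_hom {n : ℕ} {X Y : LambdaCat n} (f : X ⟶ Y) :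
    Y.lo ≤ X.lo ∧ X.hi ≤ Y.hi :=
  leOfHom ((lambdaIncl n).map f)

instance {n : ℕ} (X Y : LambdaCat n) : Subsingleton (X ⟶ Y) where
  allEq f g := ObjectProperty.hom_ext _ (Subsingleton.elim _ _)

instance {n : ℕ} (p : IntervalPoset n) (X Y : CostructuredArrow (lambdaIncl n) p) :
    Subsingleton (X ⟶ Y) where
  allEq f g := CostructuredArrow.hom_ext _ _ (Subsingleton.elim _ _)

lemma CostructuredArrow.bounds {n : ℕ} {p : IntervalPoset n}
    (X : CostructuredArrow (lambdaIncl n) p) :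
    (p.1.1 : ℕ) ≤ X.left.lo ∧ X.left.hi ≤ (p.1.2 : ℕ) :=
  leOfHom X.hom

/-- The functor `ιⁿ/[i,j] ⥤ Λ^{j-i}` translating by `-i`. -/
def shiftFunctor {n : ℕ} (p : IntervalPoset n) :
    CostructuredArrow (lambdaIncl n) p ⥤ LambdaCat p.length where
  obj X := LambdaCat.mk (X.left.lo - p.1.1) (X.left.hi - p.1.1)
    (by have := X.left.lo_le_hi; omega)
    (by have := CostructuredArrow.bounds X; unfold IntervalPoset.length; omega)
    (by have := X.left.len_le; have := CostructuredArrow.bounds X; omega)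
  map {X Y} f := LambdaCat.hom
    (by have := LambdaCat.le_of_hom f.left; exact Nat.sub_le_sub_right this.1 _)
    (by have := LambdaCat.le_of_hom f.left; exact Nat.sub_le_sub_right this.2 _)
  map_id _ := Subsingleton.elim _ _
  map_comp _ _ := Subsingleton.elim _ _

/-- The functor `Λ^{j-i} ⥤ ιⁿ/[i,j]` translating by `i`. -/
def unshiftFunctor {n : ℕ} (p : IntervalPoset n) :
    LambdaCat p.length ⥤ CostructuredArrow (lambdaIncl n) p where
  obj X := CostructuredArrow.mk (Y := LambdaCat.mk (n := n) (X.lo + p.1.1) (X.hi + p.1.1)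
      (by have := X.lo_le_hi; omega)
      (by
        have h₁ : X.hi ≤ (p.1.2 : ℕ) - (p.1.1 : ℕ) := X.hi_le
        have h₂ : (p.1.1 : ℕ) ≤ p.1.2 := p.2
        have h₃ := p.1.2.2
        omega)
      (by have := X.len_le; omega))
    (homOfLE ⟨Nat.le_add_left _ _, by
        have h₁ : X.hi ≤ (p.1.2 : ℕ) - (p.1.1 : ℕ) := X.hi_le
        have h₂ : (p.1.1 : ℕ) ≤ p.1.2 := p.2
        change X.hi + p.1.1 ≤ (p.1.2 : ℕ)
        omega⟩)
  map {X Y} f := CostructuredArrow.homMk (LambdaCat.hom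
    (by have := LambdaCat.le_of_hom f; exact Nat.add_le_add_right this.1 _)
    (by have := LambdaCat.le_of_hom f; exact Nat.add_le_add_right this.2 _))
    (Subsingleton.elim _ _)
  map_id _ := Subsingleton.elim _ _
  map_comp _ _ := Subsingleton.elim _ _

/-- Isomorphisms in `Λⁿ` from equalities of endpoints. -/
def LambdaCat.iso {n : ℕ} {X Y : LambdaCat n} (h₁ : X.lo = Y.lo) (h₂ : X.hi = Y.hi) : X ≅ Y where
  hom := LambdaCat.hom h₁.ge h₂.le
  inv := LambdaCat.hom h₁.le h₂.ge
  hom_inv_id := Subsingleton.elim _ _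
  inv_hom_id := Subsingleton.elim _ _

/-- The equivalence `ιⁿ/[i,j] ≌ Λ^{j-i}`. -/
def shiftEquiv {n : ℕ} (p : IntervalPoset n) :
    CostructuredArrow (lambdaIncl n) p ≌ LambdaCat p.length where
  functor := shiftFunctor p
  inverse := unshiftFunctor p
  unitIso := NatIso.ofComponents (fun X => CostructuredArrow.isoMk
    (LambdaCat.iso
      (by
        have := CostructuredArrow.bounds X
        change X.left.lo = X.left.lo - p.1.1 + p.1.1
        omega)
      (by
        have := CostructuredArrow.bounds X
        have := X.left.lo_le_hi
        change X.left.hi = X.left.hi - p.1.1 + p.1.1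
        omega))
    (Subsingleton.elim _ _)) (fun _ => Subsingleton.elim _ _)
  counitIso := NatIso.ofComponents (fun X => LambdaCat.iso
    (Nat.add_sub_cancel _ _) (Nat.add_sub_cancel _ _)) (fun _ => Subsingleton.elim _ _)
  functor_unitIso_comp _ := Subsingleton.elim _ _

lemma zigzag_point (n k : ℕ) (hk : k ≤ n) :
    Zigzag (LambdaCat.mk (n := n) 0 0 le_rfl (Nat.zero_le _) (by omega))
      (LambdaCat.mk k k le_rfl hk (by omega)) := by
  induction k with
  | zero => exact Zigzag.refl _
  | succ k ih =>
    refine ((ih (by omega)).trans (Zigzag.of_hom (j₂ := LambdaCat.mk k (k + 1) (by omega) hk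
      (by omega)) (LambdaCat.hom le_rfl (Nat.le_succ k)))).trans
      (Zigzag.of_inv (LambdaCat.hom (Nat.le_succ k) le_rfl))

lemma zigzag_all {n : ℕ} (X : LambdaCat n) :
    Zigzag (LambdaCat.mk (n := n) 0 0 le_rfl (Nat.zero_le _) (by omega)) X :=
  (zigzag_point n X.lo (X.lo_le_hi.trans X.hi_le)).trans
    (Zigzag.of_hom (LambdaCat.hom le_rfl X.lo_le_hi))

instance lambdaCat_isConnected (n : ℕ) : IsConnected (LambdaCat n) :=
  haveI : Nonempty (LambdaCat n) :=
    ⟨LambdaCat.mk (n := n) 0 0 le_rfl (Nat.zero_le _) (by omega)⟩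
  zigzag_isConnected fun X Y => (zigzag_all X).symm.trans (zigzag_all Y)

/-- **Statement 1.** For every `n ≥ 0` and every interval `[i,j]` in `Σⁿ`, the comma
category `ιⁿ/[i,j]` of the full inclusion `ιⁿ : Λⁿ ⥤ Σⁿ` over `[i,j]` is equivalent to
`Λ^{j-i}`; in particular every such comma category is connected, hence `ιⁿ` is an initial
functor, i.e. for every functor `G : Σⁿ ⥤ Set` the canonical map
`lim_{Σⁿ} G ⟶ lim_{Λⁿ} (G ∘ ιⁿ)` is a bijection. -/
theorem lambdaIncl_initial (n : ℕ) :
    (∀ p : IntervalPoset n,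
      Nonempty (CostructuredArrow (lambdaIncl n) p ≌ LambdaCat p.length)) ∧
    (∀ p : IntervalPoset n, IsConnected (CostructuredArrow (lambdaIncl n) p)) ∧
    (lambdaIncl n).Initial ∧
    (∀ G : IntervalPoset n ⥤ Type, Function.Bijective (limit.pre G (lambdaIncl n))) := by
  have hconn : ∀ p : IntervalPoset n, IsConnected (CostructuredArrow (lambdaIncl n) p) :=
    fun p => isConnected_of_equivalent (shiftEquiv p).symm
  have hinit : (lambdaIncl n).Initial := ⟨hconn⟩
  exact ⟨fun p => ⟨shiftEquiv p⟩, hconn, hinit, fun G =>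
    (isIso_iff_bijective _).1 inferInstance⟩

end Paper
end

section
/- For every small category C, the relative nerve functor r_C^* : Fun(C, sSet) ⥤ sSet/NC preserves filtered colimits. -/
open CategoryTheory Simplicial Opposite

universe u

namespace Paper

/-- The last vertex of `u : [k] ⟶ [n]`, i.e. `u(k)`. -/
def lastV {k n : SimplexCategory} (u : k ⟶ n) : Fin (n.len + 1) :=
  u.toOrderHom (Fin.last k.len)

variable {C : Type u} [SmallCategory C]

/-- An `n`-simplex of the relative nerve `r_C^* F`: a pair `(α, x)` of an `n`-simplex
`α` of the nerve of `C` and a compatible family `x` indexed by all maps `u : [k] ⟶ [n]`,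
such that for every factorisation `u = v ≫ u'` the two induced restrictions agree. -/
@[ext]
structure RNSimplex (F : C ⥤ SSet.{u}) (n : SimplexCategory) : Type u where
  α : ComposableArrows C n.len
  x : ∀ (k : SimplexCategory) (u : k ⟶ n), (F.obj (α.obj (lastV u))).obj (op k)
  compat : ∀ (k k' : SimplexCategory) (v : k ⟶ k') (u' : k' ⟶ n),
    (F.map (α.map (homOfLE (u'.toOrderHom.monotone (Fin.le_last _))))).app (op k)
        (x k (v ≫ u'))
      = (F.obj (α.obj (lastV u'))).map v.op (x k' u')

lemma RNSimplex.ext' {F : C ⥤ SSet.{u}} {n : SimplexCategory} {s t : RNSimplex F n}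
    (hα : s.α = t.α) (hx : ∀ (k : SimplexCategory) (u : k ⟶ n), HEq (s.x k u) (t.x k u)) :
    s = t := by
  obtain ⟨α, x, hc⟩ := s
  obtain ⟨α', x', hc'⟩ := t
  obtain rfl : α = α' := hα
  simp only [mk.injEq, heq_eq_eq, true_and]
  funext k u
  exact eq_of_heq (hx k u)

/-- The relative nerve (rectification) `r_C^* F` of a diagram `F : C ⥤ sSet`. -/
def RelNerve (F : C ⥤ SSet.{u}) : SSet.{u} where
  obj n := RNSimplex F n.unop
  map {n n'} w := ↾fun s =>
    { α := s.α.whiskerLeft (SimplexCategory.toCat.map w.unop).toFunctor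
      x := fun k u => s.x k (u ≫ w.unop)
      compat := fun k k' v u' => s.compat k k' v (u' ≫ w.unop) }
  map_id n := by
    refine ConcreteCategory.hom_ext _ _ fun s => ?_
    refine RNSimplex.ext' ?_ ?_
    · show s.α.whiskerLeft (SimplexCategory.toCat.map (𝟙 n.unop)).toFunctor = s.α
      rw [CategoryTheory.Functor.map_id]
      rfl
    · intro k u
      show HEq (s.x k (u ≫ 𝟙 n.unop)) (s.x k u)
      rw [Category.comp_id]
  map_comp {n n' n''} w w' := by
    refine ConcreteCategory.hom_ext _ _ fun s => ?_
    refine RNSimplex.ext' ?_ ?_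
    · show s.α.whiskerLeft (SimplexCategory.toCat.map (w ≫ w').unop).toFunctor
        = (s.α.whiskerLeft (SimplexCategory.toCat.map w.unop).toFunctor).whiskerLeft
            (SimplexCategory.toCat.map w'.unop).toFunctor
      rw [unop_comp, CategoryTheory.Functor.map_comp]
      rfl
    · intro k u
      show HEq (s.x k (u ≫ (w ≫ w').unop)) (s.x k ((u ≫ w'.unop) ≫ w.unop))
      rw [unop_comp, Category.assoc]

/-- The canonical projection `r_C^* F ⟶ N C`. -/
def relNerveProj (F : C ⥤ SSet.{u}) : RelNerve F ⟶ nerve C where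
  app _ := ↾fun s => s.α
  naturality _ _ _ := rfl

end Paper

namespace Paper

variable {C : Type u} [SmallCategory C]

/-- The map `r_C^*(f) : r_C^* F ⟶ r_C^* G` induced by a natural transformation `f : F ⟶ G`,
given by `(α, x) ↦ (α, (f(x_u))_u)`. -/
def relNerveMap {F G : C ⥤ SSet.{u}} (f : F ⟶ G) : RelNerve F ⟶ RelNerve G where
  app n := ↾fun s =>
    { α := s.α
      x := fun k u => (f.app (s.α.obj (lastV u))).app (op k) (s.x k u)
      compat := by
        intro k k' v u'
        have h₁ : (G.map (s.α.map (homOfLE (u'.toOrderHom.monotone (Fin.le_last _))))).app (op k)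
                ((f.app (s.α.obj (lastV (v ≫ u')))).app (op k) (s.x k (v ≫ u')))
            = (f.app (s.α.obj (lastV u'))).app (op k)
                ((F.map (s.α.map (homOfLE (u'.toOrderHom.monotone (Fin.le_last _))))).app (op k)
                  (s.x k (v ≫ u'))) := by
              exact (ConcreteCategory.congr_hom (NatTrans.congr_app
                (f.naturality (s.α.map (homOfLE (u'.toOrderHom.monotone (Fin.le_last _)))))
                (op k)) (s.x k (v ≫ u'))).symm
        have h₂ : (f.app (s.α.obj (lastV u'))).app (op k)
                ((F.map (s.α.map (homOfLE (u'.toOrderHom.monotone (Fin.le_last _))))).app (op k)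
                  (s.x k (v ≫ u')))
            = (f.app (s.α.obj (lastV u'))).app (op k)
                ((F.obj (s.α.obj (lastV u'))).map v.op (s.x k' u')) := by
              exact TypeCat.congr_arg ((f.app (s.α.obj (lastV u'))).app (op k))
                (s.compat k k' v u')
        exact h₁.trans (h₂.trans
              (NatTrans.naturality_apply (f.app (s.α.obj (lastV u'))) v.op (s.x k' u'))) }
  naturality n n' w := rfl

/-- The relative nerve as a functor `Fun(C, sSet) ⥤ sSet/N C`. -/
def relNerveFunctor (C : Type u) [SmallCategory C] :
    (C ⥤ SSet.{u}) ⥤ Over (nerve C) where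
  obj F := Over.mk (relNerveProj F)
  map f := Over.homMk (relNerveMap f) rfl

end Paper

namespace Paper

open CategoryTheory.Limits

section

variable {C : Type u} [SmallCategory C]

/-- The inclusion of the initial segment `[i] ⟶ [n]`. -/
def incl {n : SimplexCategory} (i : Fin (n.len + 1)) : SimplexCategory.mk i.val ⟶ n :=
  SimplexCategory.Hom.mk ⟨fun a => ⟨a.val, by have := a.2; have := i.2; simp at *; omega⟩,
    fun _ _ h => h⟩

/-- The inclusion of initial segments `[i] ⟶ [j]`. -/
def seg {m : ℕ} {i j : Fin m} (h : i ≤ j) :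
    SimplexCategory.mk i.val ⟶ SimplexCategory.mk j.val :=
  SimplexCategory.Hom.mk ⟨fun a => ⟨a.val, by have := a.2; simp at *; omega⟩, fun _ _ h => h⟩

/-- Every `u : [k] ⟶ [n]` factors through the initial segment ending in its last vertex. -/
def fac {k n : SimplexCategory} (u : k ⟶ n) : k ⟶ SimplexCategory.mk (lastV u).val :=
  SimplexCategory.Hom.mk ⟨fun a => ⟨(u.toOrderHom a).val,
    Nat.lt_succ_of_le (u.toOrderHom.monotone (Fin.le_last a))⟩,
    fun _ _ h => u.toOrderHom.monotone h⟩

lemma fac_incl {k n : SimplexCategory} (u : k ⟶ n) : fac u ≫ incl (lastV u) = u := by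
  ext a; rfl

lemma seg_incl {n : SimplexCategory} {i j : Fin (n.len + 1)} (h : i ≤ j) :
    seg h ≫ incl j = incl i := rfl

lemma lastV_le {k k' n : SimplexCategory} (v : k ⟶ k') (u' : k' ⟶ n) :
    lastV (v ≫ u') ≤ lastV u' := u'.toOrderHom.monotone (Fin.le_last _)

lemma fac_seg {k k' n : SimplexCategory} (v : k ⟶ k') (u' : k' ⟶ n) :
    fac (v ≫ u') ≫ seg (lastV_le v u') = v ≫ fac u' := rfl

/-- The component of a simplex at an initial segment. -/
def RNSimplex.y {F : C ⥤ SSet.{u}} {n : SimplexCategory} (s : RNSimplex F n)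
    (i : Fin (n.len + 1)) : (F.obj (s.α.obj i)).obj (op (SimplexCategory.mk i.val)) :=
  s.x _ (incl i)

lemma RNSimplex.y_compat {F : C ⥤ SSet.{u}} {n : SimplexCategory} (s : RNSimplex F n)
    {i j : Fin (n.len + 1)} (h : i ≤ j) :
    (F.map (s.α.map (homOfLE h))).app _ (s.y i) = (F.obj (s.α.obj j)).map (seg h).op (s.y j) :=
  s.compat _ _ (seg h) (incl j)

lemma RNSimplex.x_eq {F : C ⥤ SSet.{u}} {n : SimplexCategory} (s : RNSimplex F n)
    {k : SimplexCategory} (u : k ⟶ n) :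
    s.x k u = (F.obj (s.α.obj (lastV u))).map (fac u).op (s.y (lastV u)) := by
  have h := s.compat _ _ (fac u) (incl (lastV u))
  refine Eq.trans ?_ h
  have key : ∀ (u₁ : k ⟶ n) (_ : u₁ = u) (hle : lastV u₁ ≤ lastV u),
      s.x k u = (F.map (s.α.map (homOfLE hle))).app (op k) (s.x k u₁) := by
    rintro u₁ rfl hle
    have e : F.map (s.α.map (homOfLE hle)) = 𝟙 _ := by
      have : homOfLE hle = 𝟙 _ := rfl
      rw [this, s.α.map_id, F.map_id]
    exact (ConcreteCategory.congr_hom (NatTrans.congr_app e (op k)) (s.x k u₁)).symm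
  exact key _ (fac_incl u) _

/-- Construct a simplex from its components at initial segments. -/
def RNSimplex.ofY {F : C ⥤ SSet.{u}} {n : SimplexCategory} (α : ComposableArrows C n.len)
    (y : ∀ i : Fin (n.len + 1), (F.obj (α.obj i)).obj (op (SimplexCategory.mk i.val)))
    (hy : ∀ (i j : Fin (n.len + 1)) (h : i ≤ j),
      (F.map (α.map (homOfLE h))).app _ (y i) = (F.obj (α.obj j)).map (seg h).op (y j)) :
    RNSimplex F n where
  α := α
  x k u := (F.obj (α.obj (lastV u))).map (fac u).op (y (lastV u))
  compat k k' v u' := by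
    refine (NatTrans.naturality_apply (F.map (α.map (homOfLE (lastV_le v u'))))
      (fac (v ≫ u')).op (y (lastV (v ≫ u')))).trans ?_
    rw [hy]
    refine (ConcreteCategory.congr_hom
      ((F.obj (α.obj (lastV u'))).map_comp (seg (lastV_le v u')).op (fac (v ≫ u')).op) _).symm.trans ?_
    exact (ConcreteCategory.congr_hom
      ((F.obj (α.obj (lastV u'))).map_comp (fac u').op v.op) _)

lemma exists_common {J : Type u} [Category.{u} J] [IsFiltered J] {ι : Type} [Finite ι] {j₀ : J}
    (P : ι → ∀ j, (j₀ ⟶ j) → Prop)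
    (hP : ∀ i j j' (f : j₀ ⟶ j) (g : j ⟶ j'), P i j f → P i j' (f ≫ g))
    (h : ∀ i, ∃ j f, P i j f) : ∃ j f, ∀ i, P i j f := by
  classical
  cases nonempty_fintype ι
  suffices H : ∀ S : Finset ι, ∃ j f, ∀ i ∈ S, P i j f by
    obtain ⟨j, f, hf⟩ := H Finset.univ
    exact ⟨j, f, fun i => hf i (Finset.mem_univ i)⟩
  intro S
  induction S using Finset.induction with
  | empty => exact ⟨j₀, 𝟙 _, by simp⟩
  | insert a S _ ih =>
    obtain ⟨j, f, hf⟩ := ih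
    obtain ⟨j', f', hf'⟩ := h a
    obtain ⟨l, p, q, e⟩ := IsFiltered.span f f'
    refine ⟨l, f ≫ p, fun i hi => ?_⟩
    rcases Finset.mem_insert.1 hi with rfl | hi
    · rw [e]; exact hP _ _ _ _ _ hf'
    · exact hP _ _ _ _ _ (hf i hi)

section

variable {J : Type u} [Category.{u} J] {K : J ⥤ C ⥤ SSet.{u}} {c : Cocone K}

/-- The cocone evaluated at an object and a dimension. -/
abbrev evFun (C : Type u) [SmallCategory C] (a : C) (k : SimplexCategory) :
    (C ⥤ SSet.{u}) ⥤ Type u :=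
  (evaluation C SSet.{u}).obj a ⋙ (evaluation SimplexCategoryᵒᵖ (Type u)).obj (op k)

instance (a : C) (k : SimplexCategory) : PreservesColimitsOfShape J (evFun C a k) := by
  have : PreservesColimitsOfShape J ((evaluation C SSet.{u}).obj a) := inferInstance
  have : PreservesColimitsOfShape J ((evaluation SimplexCategoryᵒᵖ (Type u)).obj (op k)) :=
    inferInstance
  exact comp_preservesColimitsOfShape _ _

lemma ev_surj (hc : IsColimit c) (a : C) (k : SimplexCategory) (z : (c.pt.obj a).obj (op k)) :
    ∃ (j : J) (w : ((K.obj j).obj a).obj (op k)), ((c.ι.app j).app a).app (op k) w = z :=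
  Types.jointly_surjective_of_isColimit (isColimitOfPreserves (evFun C a k) hc) z

lemma ev_inj [IsFiltered J] (hc : IsColimit c) (a : C) (k : SimplexCategory) {j : J}
    (w w' : ((K.obj j).obj a).obj (op k))
    (h : ((c.ι.app j).app a).app (op k) w = ((c.ι.app j).app a).app (op k) w') :
    ∃ (j' : J) (f : j ⟶ j'), ((K.map f).app a).app (op k) w = ((K.map f).app a).app (op k) w' :=
  (Types.FilteredColimit.isColimit_eq_iff' (isColimitOfPreserves (evFun C a k) hc) w w').1 h

lemma K_comp {j j' j'' : J} (f : j ⟶ j') (g : j' ⟶ j'') (a : C) (k : SimplexCategory)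
    (w : ((K.obj j).obj a).obj (op k)) :
    ((K.map (f ≫ g)).app a).app (op k) w
      = ((K.map g).app a).app (op k) (((K.map f).app a).app (op k) w) :=
  ConcreteCategory.congr_hom ((K ⋙ evFun C a k).map_comp f g) w

lemma c_w {j j' : J} (f : j ⟶ j') (a : C) (k : SimplexCategory)
    (w : ((K.obj j).obj a).obj (op k)) :
    ((c.ι.app j').app a).app (op k) (((K.map f).app a).app (op k) w)
      = ((c.ι.app j).app a).app (op k) w :=
  ConcreteCategory.congr_hom (((evFun C a k).mapCocone c).w f) w

lemma nat_C {F G : C ⥤ SSet.{u}} (f : F ⟶ G) {a b : C} (g : a ⟶ b) (k : SimplexCategory)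
    (w : (F.obj a).obj (op k)) :
    (G.map g).app (op k) ((f.app a).app (op k) w)
      = (f.app b).app (op k) ((F.map g).app (op k) w) :=
  (ConcreteCategory.congr_hom (NatTrans.congr_app (f.naturality g) (op k)) w).symm

lemma nat_S {F G : C ⥤ SSet.{u}} (f : F ⟶ G) (a : C) {k l : SimplexCategory} (v : k ⟶ l)
    (w : (F.obj a).obj (op l)) :
    (G.obj a).map v.op ((f.app a).app (op l) w)
      = (f.app a).app (op k) ((F.obj a).map v.op w) :=
  (NatTrans.naturality_apply (f.app a) v.op w).symm

lemma rn_inj [IsFiltered J] (hc : IsColimit c) (n : SimplexCategory) {j : J}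
    (s t : RNSimplex (K.obj j) n)
    (h : (relNerveMap (c.ι.app j)).app (op n) s = (relNerveMap (c.ι.app j)).app (op n) t) :
    ∃ (j' : J) (f : j ⟶ j'),
      (relNerveMap (K.map f)).app (op n) s = (relNerveMap (K.map f)).app (op n) t := by
  obtain ⟨α, x, hx⟩ := s
  obtain ⟨β, x', hx'⟩ := t
  obtain rfl : α = β := congrArg RNSimplex.α h
  have h2 := (RNSimplex.mk.inj h).2
  have h3 := eq_of_heq h2
  let s : RNSimplex (K.obj j) n := ⟨α, x, hx⟩
  let t : RNSimplex (K.obj j) n := ⟨α, x', hx'⟩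
  obtain ⟨j', f, hf⟩ := exists_common (j₀ := j) (ι := Fin (n.len + 1))
    (fun i j' f => ((K.map f).app (α.obj i)).app _ (s.y i) = ((K.map f).app (α.obj i)).app _ (t.y i))
    (by
      intro i j j' f g e
      rw [K_comp, K_comp, e])
    (fun i => ev_inj hc _ _ _ _ (congrFun (congrFun h3 _) (incl i)))
  refine ⟨j', f, RNSimplex.ext' rfl fun k u => heq_of_eq ?_⟩
  show ((K.map f).app (α.obj (lastV u))).app (op k) (s.x k u)
    = ((K.map f).app (α.obj (lastV u))).app (op k) (t.x k u)
  rw [s.x_eq, t.x_eq]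
  refine (nat_S (K.map f) _ (fac u) _).symm.trans ?_
  refine Eq.trans ?_ (nat_S (K.map f) _ (fac u) _)
  exact congrArg _ (hf (lastV u))

lemma rn_surj [IsFiltered J] (hc : IsColimit c) (n : SimplexCategory) (s : RNSimplex c.pt n) :
    ∃ (j : J) (t : RNSimplex (K.obj j) n), s = (relNerveMap (c.ι.app j)).app (op n) t := by
  classical
  choose j₁ w₁ hw₁ using fun i => ev_surj hc _ _ (s.y i)
  obtain ⟨j₂, hj₂⟩ := IsFiltered.sup_objs_exists (Finset.univ.image j₁)
  have g : ∀ i, j₁ i ⟶ j₂ := fun i =>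
    (hj₂ (Finset.mem_image_of_mem j₁ (Finset.mem_univ i))).some
  let w₂ := fun i => ((K.map (g i)).app _).app _ (w₁ i)
  have hw₂ : ∀ i, ((c.ι.app j₂).app _).app _ (w₂ i) = s.y i := fun i =>
    (c_w (g i) _ _ (w₁ i)).trans (hw₁ i)
  obtain ⟨j, f, hf⟩ := exists_common (j₀ := j₂)
    (ι := {p : Fin (n.len + 1) × Fin (n.len + 1) // p.1 ≤ p.2})
    (fun p j' f => ((K.map f).app _).app _
        (((K.obj j₂).map (s.α.map (homOfLE p.2))).app _ (w₂ p.1.1))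
      = ((K.map f).app _).app _ (((K.obj j₂).obj _).map (seg p.2).op (w₂ p.1.2)))
    (by
      intro i j j' f g e
      rw [K_comp, K_comp, e])
    (fun p => ev_inj hc _ _ _ _ (by
      rw [← nat_C, ← nat_S, hw₂, hw₂]
      exact s.y_compat p.2))
  refine ⟨j, RNSimplex.ofY s.α (fun i => ((K.map f).app _).app _ (w₂ i)) ?_, ?_⟩
  · intro i i' h
    rw [nat_C, nat_S]
    exact hf ⟨(i, i'), h⟩
  · refine RNSimplex.ext' rfl fun k u => heq_of_eq ?_
    rw [s.x_eq]
    refine Eq.trans ?_ (nat_S (c.ι.app j) _ (fac u) _)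
    refine congrArg _ ?_
    exact ((c_w f _ _ (w₂ _)).trans (hw₂ _)).symm

end

end

/-- **Statement 5.** For every small category `C`, the relative nerve functor
`r_C^* : Fun(C, sSet) ⥤ sSet/N C` preserves filtered colimits. -/
theorem relNerveFunctor_preservesFilteredColimits (C : Type u) [SmallCategory C] :
    Nonempty (PreservesFilteredColimitsOfSize.{u, u} (relNerveFunctor C)) := by
  refine ⟨⟨fun J _ _ => ⟨fun {K} => ⟨fun {c} hc => ⟨?_⟩⟩⟩⟩⟩
  refine isColimitOfReflects (Over.forget (nerve C)) ?_
  refine evaluationJointlyReflectsColimits _ fun n => ?_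
  refine Types.FilteredColimit.isColimitOf' _ _ ?_ ?_
  · intro x
    exact rn_surj hc n.unop x
  · intro j x y h
    exact rn_inj hc n.unop x y h

end Paper
end

section
/- Let C be a small category and F : C ⥤ sSet a functor such that F(c) is a Kan complex for every object c of C and F(g) is a weak homotopy equivalence for every morphism g of C. Then the projection r_C^*F → NC is a Kan fibration. -/
open CategoryTheory Simplicial Opposite

universe u


namespace Paper

/-- The (objectwise) product of two simplicial sets. -/
def sprod (A B : SSet.{u}) : SSet.{u} where
  obj n := A.obj n × B.obj n
  map w := ↾fun p => (A.map w p.1, B.map w p.2)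
  map_id n := by refine ConcreteCategory.hom_ext _ _ fun p => ?_; simp
  map_comp f g := by refine ConcreteCategory.hom_ext _ _ fun p => ?_; simp

/-- The product of two maps of simplicial sets. -/
def sprodMap {A A' B B' : SSet.{u}} (f : A ⟶ A') (g : B ⟶ B') : sprod A B ⟶ sprod A' B' where
  app n := ↾fun p => (f.app n p.1, g.app n p.2)
  naturality m m' w := by
    refine ConcreteCategory.hom_ext _ _ fun p => ?_
    obtain ⟨a, b⟩ := p
    show (f.app m' (A.map w a), g.app m' (B.map w b))
      = (A'.map w (f.app m a), B'.map w (g.app m b))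
    rw [NatTrans.naturality_apply, NatTrans.naturality_apply]

/-- The inclusion `X ≅ Δ^{(k)} × X ⟶ Δ¹ × X` at the vertex `k`. -/
def vertexIncl (k : Fin 2) (X : SSet.{u}) : X ⟶ sprod Δ[1] X where
  app n := ↾fun x => (SSet.stdSimplex.const 1 k n, x)
  naturality m m' w := by
    refine ConcreteCategory.hom_ext _ _ fun x => ?_
    simp only [sprod, types_comp_apply]
    refine Prod.ext ?_ rfl
    rfl

/-- Two maps `f g : X ⟶ K` are (simplicially) homotopic if there is a homotopy
`H : Δ¹ × X ⟶ K` from `f` to `g`. -/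
def SHomotopic {X K : SSet.{u}} (f g : X ⟶ K) : Prop :=
  ∃ H : sprod Δ[1] X ⟶ K, vertexIncl 0 X ≫ H = f ∧ vertexIncl 1 X ≫ H = g

/-- Homotopy classes of maps `X ⟶ K`. -/
def HtpyClasses (X K : SSet.{u}) : Type u :=
  Quot (fun f g : X ⟶ K => SHomotopic f g)

lemma vertexIncl_naturality {X Y : SSet.{u}} (k : Fin 2) (f : X ⟶ Y) :
    vertexIncl k X ≫ sprodMap (𝟙 Δ[1]) f = f ≫ vertexIncl k Y := rfl

/-- Precomposition with `f : X ⟶ Y` on homotopy classes of maps into `K`. -/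
def precompCls {X Y : SSet.{u}} (f : X ⟶ Y) (K : SSet.{u}) :
    HtpyClasses Y K → HtpyClasses X K :=
  Quot.map (fun g => f ≫ g) (by
    rintro g g' ⟨H, h0, h1⟩
    refine ⟨sprodMap (𝟙 Δ[1]) f ≫ H, ?_, ?_⟩
    · rw [← Category.assoc, vertexIncl_naturality, Category.assoc, h0]
    · rw [← Category.assoc, vertexIncl_naturality, Category.assoc, h1])

/-- A Kan complex: a simplicial set with the extension property along all horn
inclusions `Λᵏᵢ ⊆ Δᵏ`. -/
def IsKan (K : SSet.{u}) : Prop :=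
  ∀ ⦃n : ℕ⦄ ⦃i : Fin (n + 1)⦄ (σ₀ : (Λ[n, i] : SSet.{u}) ⟶ K), ∃ σ : Δ[n] ⟶ K,
    σ₀ = Λ[n, i].ι ≫ σ

/-- A map `f : X ⟶ Y` of simplicial sets is a weak homotopy equivalence (equivalently, a
weak equivalence in the Kan–Quillen model structure) if for every Kan complex `K` the
induced map `[Y, K] ⟶ [X, K]` on homotopy classes of maps is a bijection. -/
def WeakHomotopyEquiv {X Y : SSet.{u}} (f : X ⟶ Y) : Prop :=
  ∀ K : SSet.{u}, IsKan K → Function.Bijective (precompCls f K)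

end Paper

namespace Paper

/-- A Kan fibration: a map of simplicial sets with the right lifting property with respect
to all horn inclusions `Λᵏᵢ ⊆ Δᵏ`, `k ≥ 1`, `0 ≤ i ≤ k`. -/
def KanFibration {X Y : SSet.{u}} (p : X ⟶ Y) : Prop :=
  ∀ ⦃k : ℕ⦄ (i : Fin (k + 1)), 1 ≤ k → HasLiftingProperty Λ[k, i].ι p

section HomotopyPart

open MonoidalCategory CartesianMonoidalCategory HomotopicalAlgebra SSet
open SSet.modelCategoryQuillen

lemma lift_pp {A X T Z E B : SSet.{u}} (i : A ⟶ X) (j : T ⟶ Z) (p : E ⟶ B)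
    (sq : (curriedTensor _).PushoutObjObj i j) (h : anodyneExtensions sq.ι) [hp : Fibration p]
    (a : X ⊗ T ⟶ E) (v : A ⊗ Z ⟶ E) (w : X ⊗ Z ⟶ B)
    (h₁ : i ▷ T ≫ a = A ◁ j ≫ v) (h₂ : X ◁ j ≫ w = a ≫ p) (h₃ : i ▷ Z ≫ w = v ≫ p) :
    ∃ l : X ⊗ Z ⟶ E, X ◁ j ≫ l = a ∧ i ▷ Z ≫ l = v ∧ l ≫ p = w := by
  have h0 := h p ((HomotopicalAlgebra.fibration_iff p).1 hp)
  have e₁ : sq.inl ≫ sq.ι = X ◁ j := sq.inl_ι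
  have e₂ : sq.inr ≫ sq.ι = i ▷ Z := sq.inr_ι
  have s : CommSq (sq.isPushout.desc a v h₁) sq.ι p w := ⟨by
    apply sq.isPushout.hom_ext
    · rw [← Category.assoc, sq.isPushout.inl_desc, ← Category.assoc, e₁, h₂]
    · rw [← Category.assoc, sq.isPushout.inr_desc, ← Category.assoc, e₂, h₃]⟩
  refine ⟨s.lift, ?_, ?_, s.fac_right⟩
  · rw [← e₁, Category.assoc, s.fac_left, sq.isPushout.inl_desc]
  · rw [← e₂, Category.assoc, s.fac_left, sq.isPushout.inr_desc]

lemma lift_pp_right {A X T Z E B : SSet.{u}} (i : A ⟶ X) [Mono i] (j : T ⟶ Z)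
    (hj : anodyneExtensions j) (p : E ⟶ B) [Fibration p]
    (a : X ⊗ T ⟶ E) (v : A ⊗ Z ⟶ E) (w : X ⊗ Z ⟶ B)
    (h₁ : i ▷ T ≫ a = A ◁ j ≫ v) (h₂ : X ◁ j ≫ w = a ≫ p) (h₃ : i ▷ Z ≫ w = v ≫ p) :
    ∃ l : X ⊗ Z ⟶ E, X ◁ j ≫ l = a ∧ i ▷ Z ≫ l = v ∧ l ≫ p = w :=
  lift_pp i j p (.ofHasPushout _ i j) (anodyneExtensions_pushoutObjObjι _ hj) a v w h₁ h₂ h₃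

lemma lift_pp_left {A X T Z E B : SSet.{u}} (i : A ⟶ X) (hi : anodyneExtensions i) (j : T ⟶ Z)
    [Mono j] (p : E ⟶ B) [Fibration p]
    (a : X ⊗ T ⟶ E) (v : A ⊗ Z ⟶ E) (w : X ⊗ Z ⟶ B)
    (h₁ : i ▷ T ≫ a = A ◁ j ≫ v) (h₂ : X ◁ j ≫ w = a ≫ p) (h₃ : i ▷ Z ≫ w = v ≫ p) :
    ∃ l : X ⊗ Z ⟶ E, X ◁ j ≫ l = a ∧ i ▷ Z ≫ l = v ∧ l ≫ p = w :=
  lift_pp i j p (.ofHasPushout _ i j) (anodyneExtensions_pushoutObjObjι' _ hi) a v w h₁ h₂ h₃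

/-- The inclusion of the vertex 1 in the interval. -/
noncomputable def v1 : (𝟙_ SSet.{u}) ⟶ Δ[1] := SSet.const (stdSimplex.obj₀Equiv.{u}.symm 1)

lemma horn11_apply {n : SimplexCategoryᵒᵖ} (x : (Δ[1] : SSet.{u}).obj n)
    (hx : x ∈ (Λ[1, 1] : (Δ[1] : SSet.{u}).Subcomplex).obj n) (k : Fin (n.unop.len + 1)) :
    stdSimplex.asOrderHom x k = 1 := by
  rw [mem_horn_iff] at hx
  by_contra h
  apply hx
  have h0 : stdSimplex.asOrderHom x k = 0 := by
    generalize stdSimplex.asOrderHom x k = a at h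
    fin_cases a
    · rfl
    · exact absurd rfl h
  ext a
  fin_cases a
  · simp only [Set.mem_union, Set.mem_univ, iff_true]
    exact Or.inl ⟨k, h0⟩
  · simp

lemma stdSimplex_ext {m : ℕ} {n : SimplexCategoryᵒᵖ} (x y : (Δ[m] : SSet.{u}).obj n)
    (h : ∀ k, stdSimplex.asOrderHom x k = stdSimplex.asOrderHom y k) : x = y := by
  apply stdSimplex.objEquiv.injective
  ext k : 3
  exact h k

lemma asOrderHom_const (m : ℕ) (k : Fin (m + 1)) (n : SimplexCategoryᵒᵖ)
    (i : Fin (n.unop.len + 1)) :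
    stdSimplex.asOrderHom (stdSimplex.const.{u} m k n) i = k := rfl

lemma v1_app (n : SimplexCategoryᵒᵖ) (x : (𝟙_ SSet.{u}).obj n) (k : Fin (n.unop.len + 1)) :
    stdSimplex.asOrderHom (v1.{u}.app n x) k = 1 := rfl

lemma v1_mem (n : SimplexCategoryᵒᵖ) (x : (𝟙_ SSet.{u}).obj n) :
    v1.{u}.app n x ∈ (Λ[1, 1] : (Δ[1] : SSet.{u}).Subcomplex).obj n := by
  rw [mem_horn_iff]
  intro h
  have h0 : (0 : Fin 2) ∈ Set.range (stdSimplex.asOrderHom (v1.{u}.app n x)) ∪ {1} := by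
    rw [h]; trivial
  rcases h0 with ⟨k, hk⟩ | h0
  · rw [v1_app] at hk
    exact absurd hk (by decide)
  · exact absurd h0 (by decide)

/-- The horn `Λ[1, 1]` is a point. -/
noncomputable def v1Iso : (𝟙_ SSet.{u}) ≅ (Λ[1, 1] : SSet.{u}) where
  hom := { app := fun n => ↾fun x => ⟨v1.app n x, v1_mem n x⟩
           naturality := fun _ _ _ => rfl }
  inv := toUnit _
  hom_inv_id := toUnit_unique _ _
  inv_hom_id := by
    refine NatTrans.ext (funext fun n => ConcreteCategory.hom_ext _ _ fun x => ?_)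
    refine Subtype.ext (stdSimplex_ext _ _ fun k => ?_)
    exact (horn11_apply x.1 x.2 k).symm

lemma v1_anodyne : anodyneExtensions (v1.{u}) := by
  have h : v1.{u} = v1Iso.hom ≫ Λ[1, 1].ι := rfl
  rw [h]
  exact anodyneExtensions.comp_mem _ _ (anodyneExtensions.of_isIso v1Iso.hom)
    (anodyneExtensions.horn_ι 1)

lemma whisker_v1 (X : SSet.{u}) : X ◁ v1 = (ρ_ X).hom ≫ (SSet.ι₁ : X ⟶ X ⊗ Δ[1]) := rfl

/-- Homotopy lifting-extension at the vertex 1. -/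
lemma hlep {A X E B : SSet.{u}} (i : A ⟶ X) [Mono i] (p : E ⟶ B) [Fibration p]
    (a : X ⟶ E) (v : A ⊗ Δ[1] ⟶ E) (w : X ⊗ Δ[1] ⟶ B)
    (h₁ : i ≫ a = ι₁ ≫ v) (h₂ : ι₁ ≫ w = a ≫ p) (h₃ : i ▷ Δ[1] ≫ w = v ≫ p) :
    ∃ l : X ⊗ Δ[1] ⟶ E, ι₁ ≫ l = a ∧ i ▷ Δ[1] ≫ l = v ∧ l ≫ p = w := by
  obtain ⟨l, h, h', h''⟩ := lift_pp_right i v1 v1_anodyne p ((ρ_ X).hom ≫ a) v w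
    (by rw [whisker_v1, Category.assoc, ← h₁]; rfl)
    (by rw [whisker_v1, Category.assoc, h₂]; rfl) h₃
  rw [whisker_v1, Category.assoc, cancel_epi] at h
  exact ⟨l, h, h', h''⟩

lemma hlp {X E B : SSet.{u}} (p : E ⟶ B) [hp : Fibration p]
    (a : X ⟶ E) (w : X ⊗ Δ[1] ⟶ B) (h₂ : ι₁ ≫ w = a ≫ p) :
    ∃ l : X ⊗ Δ[1] ⟶ E, ι₁ ≫ l = a ∧ l ≫ p = w := by
  have h0 := (v1_anodyne.whiskerLeft X) p ((HomotopicalAlgebra.fibration_iff p).1 hp)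
  have s : CommSq ((ρ_ X).hom ≫ a) (X ◁ v1) p w :=
    ⟨by rw [whisker_v1, Category.assoc, Category.assoc, h₂]⟩
  have : X ◁ v1 ≫ s.lift = (ρ_ X).hom ≫ a := s.fac_left
  generalize s.lift = l at this
  have : ι₁ ≫ s.lift = a := by
    rw [← cancel_epi (ρ_ X).hom, ← Category.assoc]
    exact s.fac_left
  exact ⟨s.lift, this, s.fac_right⟩

lemma boundary1_apply {n : SimplexCategoryᵒᵖ} (x : (Δ[1] : SSet.{u}).obj n)
    (hx : x ∈ (∂Δ[1] : (Δ[1] : SSet.{u}).Subcomplex).obj n) (k l : Fin (n.unop.len + 1)) :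
    stdSimplex.asOrderHom x k = stdSimplex.asOrderHom x l := by
  by_contra h
  apply hx
  intro a
  by_cases ha : stdSimplex.asOrderHom x k = a
  · exact ⟨k, ha⟩
  · refine ⟨l, ?_⟩
    generalize stdSimplex.asOrderHom x k = b at *
    generalize stdSimplex.asOrderHom x l = c at *
    revert a b c
    decide

open Classical in
/-- Two maps define a map on the product with the boundary of the interval. -/
noncomputable def glue {X E : SSet.{u}} (f g : X ⟶ E) : X ⊗ (∂Δ[1] : SSet.{u}) ⟶ E where
  app n := ↾fun z => if stdSimplex.asOrderHom z.2.1 0 = 0 then f.app n z.1 else g.app n z.1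
  naturality n m w := by
    refine ConcreteCategory.hom_ext _ _ fun z => ?_
    obtain ⟨x, t, ht⟩ := z
    have e : stdSimplex.asOrderHom ((Δ[1] : SSet.{u}).map w t) 0
        = stdSimplex.asOrderHom t 0 := boundary1_apply t ht _ _
    show (if stdSimplex.asOrderHom ((Δ[1] : SSet.{u}).map w t) 0 = 0
        then f.app m (X.map w x) else g.app m (X.map w x))
      = E.map w (if stdSimplex.asOrderHom t 0 = 0 then f.app n x else g.app n x)
    rw [e]
    split_ifs
    · exact NatTrans.naturality_apply f w x
    · exact NatTrans.naturality_apply g w x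

lemma glue_app {X E : SSet.{u}} (f g : X ⟶ E) (n : SimplexCategoryᵒᵖ) (x : X.obj n)
    (t : (Δ[1] : SSet.{u}).obj n)
    (ht : t ∈ (∂Δ[1] : (Δ[1] : SSet.{u}).Subcomplex).obj n) :
    (stdSimplex.asOrderHom t 0 = 0 ∧ t = stdSimplex.const 1 0 n ∧
      (glue f g).app n (x, ⟨t, ht⟩) = f.app n x) ∨
    (stdSimplex.asOrderHom t 0 = 1 ∧ t = stdSimplex.const 1 1 n ∧
      (glue f g).app n (x, ⟨t, ht⟩) = g.app n x) := by
  by_cases h : stdSimplex.asOrderHom t 0 = 0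
  · refine Or.inl ⟨h, stdSimplex_ext _ _ fun k => ?_, if_pos h⟩
    rw [boundary1_apply t ht k 0, h]; rfl
  · have h1 : stdSimplex.asOrderHom t 0 = 1 := by
      generalize stdSimplex.asOrderHom t 0 = a at h
      revert a; decide
    refine Or.inr ⟨h1, stdSimplex_ext _ _ fun k => ?_, if_neg h⟩
    rw [boundary1_apply t ht k 0, h1]; rfl

lemma const_mem (k : Fin 2) (n : SimplexCategoryᵒᵖ) :
    stdSimplex.const.{u} 1 k n ∈ (∂Δ[1] : (Δ[1] : SSet.{u}).Subcomplex).obj n := by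
  intro h
  obtain ⟨a, ha⟩ := h (1 - k)
  rw [asOrderHom_const] at ha
  clear h a
  revert k; decide

lemma glue_app_zero {X E : SSet.{u}} (f g : X ⟶ E) (n : SimplexCategoryᵒᵖ) (x : X.obj n) :
    (glue f g).app n (x, ⟨stdSimplex.const 1 0 n, const_mem 0 n⟩) = f.app n x := by
  rcases glue_app f g n x _ (const_mem 0 n) with ⟨-, -, h⟩ | ⟨h, -, -⟩
  · exact h
  · rw [asOrderHom_const] at h
    exact absurd h (by decide)

lemma glue_app_one {X E : SSet.{u}} (f g : X ⟶ E) (n : SimplexCategoryᵒᵖ) (x : X.obj n) :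
    (glue f g).app n (x, ⟨stdSimplex.const 1 1 n, const_mem 1 n⟩) = g.app n x := by
  rcases glue_app f g n x _ (const_mem 1 n) with ⟨h, -, -⟩ | ⟨-, -, h⟩
  · rw [asOrderHom_const] at h
    exact absurd h (by decide)
  · exact h

lemma glue_uniq {X E : SSet.{u}} (f g : X ⟶ E) (h : X ⊗ (∂Δ[1] : SSet.{u}) ⟶ E)
    (h0 : ∀ n x, h.app n (x, ⟨stdSimplex.const 1 0 n, const_mem 0 n⟩) = f.app n x)
    (h1 : ∀ n x, h.app n (x, ⟨stdSimplex.const 1 1 n, const_mem 1 n⟩) = g.app n x) :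
    glue f g = h := by
  refine NatTrans.ext (funext fun n => ConcreteCategory.hom_ext _ _ fun z => ?_)
  obtain ⟨x, t, ht⟩ := z
  rcases glue_app f g n x t ht with ⟨-, h2, -⟩ | ⟨-, h2, -⟩
  · subst h2
    exact (glue_app_zero f g n x).trans (h0 n x).symm
  · subst h2
    exact (glue_app_one f g n x).trans (h1 n x).symm

lemma app_congr {X Y : SSet.{u}} {f g : X ⟶ Y} (h : f = g) (n : SimplexCategoryᵒᵖ)
    (x : X.obj n) : f.app n x = g.app n x := by rw [h]

lemma sset_ext {X Y : SSet.{u}} {f g : X ⟶ Y} (h : ∀ n x, f.app n x = g.app n x) : f = g :=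
  NatTrans.ext (funext fun n => ConcreteCategory.hom_ext _ _ fun x => h n x)

/-- Permutation of factors. -/
noncomputable def perm (Z A B : SSet.{u}) : (Z ⊗ A) ⊗ B ⟶ (Z ⊗ B) ⊗ A :=
  lift (lift (fst _ _ ≫ fst _ _) (snd _ _)) (fst _ _ ≫ snd _ _)

lemma mono_whisker (Z : SSet.{u}) {A B : SSet.{u}} (i : A ⟶ B) [Mono i] : Mono (Z ◁ i) where
  right_cancellation f g h := by
    have h1 := congrArg (fun t => t ≫ fst _ _) h
    have h2 := congrArg (fun t => t ≫ snd _ _) h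
    simp only [Category.assoc, whiskerLeft_fst, whiskerLeft_snd] at h1 h2
    refine CartesianMonoidalCategory.hom_ext _ _ h1 ?_
    rw [← cancel_mono i, Category.assoc, Category.assoc]
    exact h2

lemma euclid {Z E B : SSet.{u}} (p : E ⟶ B) [Fibration p] (H0 H1 : Z ⊗ Δ[1] ⟶ E) (e : Z ⟶ E)
    (h0 : ι₁ ≫ H0 = e) (h1 : ι₁ ≫ H1 = e) (hp : H0 ≫ p = H1 ≫ p) :
    ∃ G : Z ⊗ Δ[1] ⟶ E, ι₀ ≫ G = ι₀ ≫ H0 ∧ ι₁ ≫ G = ι₀ ≫ H1 ∧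
      G ≫ p = fst Z Δ[1] ≫ ι₀ ≫ H0 ≫ p := by
  haveI := mono_whisker Z (∂Δ[1] : (Δ[1] : SSet.{u}).Subcomplex).ι
  obtain ⟨l, e1, e2, e3⟩ := hlep (Z ◁ (∂Δ[1] : (Δ[1] : SSet.{u}).Subcomplex).ι) p
    (fst Z Δ[1] ≫ e) (perm Z _ _ ≫ glue H0 H1) (fst Z Δ[1] ▷ Δ[1] ≫ H0 ≫ p)
    (by
      refine sset_ext fun n x => ?_
      obtain ⟨z, t, ht⟩ := x
      rcases glue_app H0 H1 n (z, stdSimplex.const 1 1 n) t ht with ⟨-, -, h⟩ | ⟨-, -, h⟩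
      · exact (app_congr h0 n z).symm.trans h.symm
      · exact (app_congr h1 n z).symm.trans h.symm)
    (by
      rw [← h0]; rfl)
    (by
      refine sset_ext fun n x => ?_
      obtain ⟨⟨z, t, ht⟩, s⟩ := x
      rcases glue_app H0 H1 n (z, s) t ht with ⟨-, -, h⟩ | ⟨-, -, h⟩
      · exact (congrArg (p.app n) h).symm
      · exact (app_congr hp n (z, s)).trans (congrArg (p.app n) h).symm)
  refine ⟨ι₀ ≫ l, ?_, ?_, ?_⟩
  · refine sset_ext fun n z => ?_
    exact (app_congr e2 n ((z, ⟨_, const_mem 0 n⟩), stdSimplex.const 1 0 n)).trans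
      (glue_app_zero H0 H1 n (z, stdSimplex.const 1 0 n))
  · refine sset_ext fun n z => ?_
    exact (app_congr e2 n ((z, ⟨_, const_mem 1 n⟩), stdSimplex.const 1 0 n)).trans
      (glue_app_one H0 H1 n (z, stdSimplex.const 1 0 n))
  · rw [Category.assoc, e3]; rfl

lemma fibration_toUnit {K : SSet.{u}} (hK : IsKan K) : Fibration (toUnit K) := by
  rw [modelCategoryQuillen.fibration_iff]
  intro _ _ _ hf
  simp only [J, MorphismProperty.iSup_iff] at hf
  obtain ⟨n, ⟨i⟩⟩ := hf
  refine ⟨fun {t _} _ ↦ ?_⟩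
  obtain ⟨φ, hφ⟩ := hK t
  exact ⟨⟨{ l := φ, fac_left := hφ.symm, fac_right := toUnit_unique _ _ }⟩⟩

lemma horn0_empty {n : SimplexCategoryᵒᵖ} (i : Fin 1) (x : (Δ[0] : SSet.{u}).obj n)
    (hx : x ∈ (Λ[0, i] : (Δ[0] : SSet.{u}).Subcomplex).obj n) : False := by
  rw [mem_horn_iff] at hx
  apply hx
  ext a
  simp only [Set.mem_union, Set.mem_univ, iff_true]
  exact Or.inr (Subsingleton.elim (α := Fin 1) _ _)

lemma isKan_of_fibration {K : SSet.{u}} [Fibration (toUnit K)] (s : Δ[0] ⟶ K) : IsKan K := by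
  intro n i σ₀
  obtain _ | n := n
  · exact ⟨s, sset_ext fun n x => (horn0_empty i x.1 x.2).elim⟩
  · have sq : CommSq σ₀ Λ[n + 1, i].ι (toUnit K) (toUnit _) := ⟨toUnit_unique _ _⟩
    exact ⟨sq.lift, sq.fac_left.symm⟩

/-- Swap. -/
def swapTo (X : SSet.{u}) : X ⊗ Δ[1] ⟶ sprod Δ[1] X where
  app _ := ↾fun z => (z.2, z.1)
  naturality _ _ _ := rfl

/-- Swap. -/
def swapFrom (X : SSet.{u}) : sprod Δ[1] X ⟶ X ⊗ Δ[1] where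
  app _ := ↾fun z => (z.2, z.1)
  naturality _ _ _ := rfl

lemma shom_iff {X K : SSet.{u}} (f g : X ⟶ K) :
    SHomotopic f g ↔ ∃ H : X ⊗ Δ[1] ⟶ K, ι₀ ≫ H = f ∧ ι₁ ≫ H = g := by
  constructor
  · rintro ⟨H, h0, h1⟩
    exact ⟨swapTo X ≫ H, h0, h1⟩
  · rintro ⟨H, h0, h1⟩
    exact ⟨swapFrom X ≫ H, h0, h1⟩

lemma shom_refl {X K : SSet.{u}} (f : X ⟶ K) : SHomotopic f f :=
  (shom_iff f f).2 ⟨fst _ _ ≫ f, rfl, rfl⟩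

lemma shom_euclid {X K : SSet.{u}} [Fibration (toUnit K)] {f g e : X ⟶ K}
    (h : SHomotopic f e) (h' : SHomotopic g e) : SHomotopic f g := by
  rw [shom_iff] at *
  obtain ⟨H, a, b⟩ := h
  obtain ⟨H', a', b'⟩ := h'
  obtain ⟨G, c, c', -⟩ := euclid (toUnit K) H H' e b b' (toUnit_unique _ _)
  exact ⟨G, c.trans a, c'.trans a'⟩

lemma shom_symm {X K : SSet.{u}} [Fibration (toUnit K)] {f g : X ⟶ K}
    (h : SHomotopic f g) : SHomotopic g f := shom_euclid (shom_refl g) h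

lemma shom_trans {X K : SSet.{u}} [Fibration (toUnit K)] {f g e : X ⟶ K}
    (h : SHomotopic f g) (h' : SHomotopic g e) : SHomotopic f e := shom_euclid h (shom_symm h')

lemma shom_of_quot {X K : SSet.{u}} [Fibration (toUnit K)] {f g : X ⟶ K}
    (h : (Quot.mk _ f : HtpyClasses X K) = Quot.mk _ g) : SHomotopic f g := by
  have h' := Quot.eqvGen_exact h
  clear h
  induction h' with
  | rel _ _ h => exact h
  | refl _ => exact shom_refl _
  | symm _ _ _ h => exact shom_symm h
  | trans _ _ _ _ _ h h' => exact shom_trans h h'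

lemma exists_factor {X Y : SSet.{u}} (f : X ⟶ Y) :
    ∃ (P : SSet.{u}) (j : X ⟶ P) (q : P ⟶ Y), anodyneExtensions j ∧ Fibration q ∧ j ≫ q = f := by
  let d := MorphismProperty.factorizationData J.{u}.rlp.llp J.{u}.rlp f
  refine ⟨d.Z, d.i, d.p, ?_, ?_, d.fac⟩
  · rw [anodyneExtensions_eq_llp_rlp]
    exact d.hi
  · rw [modelCategoryQuillen.fibration_iff]
    exact d.hp


lemma cls_surj {X Y K : SSet.{u}} {f : X ⟶ Y} (h : Function.Surjective (precompCls f K))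
    [Fibration (toUnit K)] (g : X ⟶ K) : ∃ g' : Y ⟶ K, SHomotopic (f ≫ g') g := by
  obtain ⟨c, hc⟩ := h (Quot.mk _ g)
  obtain ⟨g', rfl⟩ := Quot.exists_rep c
  exact ⟨g', shom_of_quot hc⟩

lemma cls_inj {X Y K : SSet.{u}} {f : X ⟶ Y} (h : Function.Injective (precompCls f K))
    [Fibration (toUnit K)] (g g' : Y ⟶ K) (e : SHomotopic (f ≫ g) (f ≫ g')) :
    SHomotopic g g' := by
  refine shom_of_quot (h ?_)
  exact Quot.sound e

lemma shom_comp {X Y Z : SSet.{u}} {f g : X ⟶ Y} (h : SHomotopic f g) (k : Y ⟶ Z) :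
    SHomotopic (f ≫ k) (g ≫ k) := by
  obtain ⟨H, h0, h1⟩ := h
  exact ⟨H ≫ k, by rw [← h0]; rfl, by rw [← h1]; rfl⟩

lemma shom_precomp {W X Y : SSet.{u}} (k : W ⟶ X) {f g : X ⟶ Y} (h : SHomotopic f g) :
    SHomotopic (k ≫ f) (k ≫ g) := by
  obtain ⟨H, h0, h1⟩ := h
  exact ⟨sprodMap (𝟙 _) k ≫ H, by rw [← h0]; rfl, by rw [← h1]; rfl⟩

/-- A factorisation of a weak equivalence between Kan complexes. -/
lemma factor {X Y : SSet.{u}} (hX : IsKan X) (hY : IsKan Y) (f : X ⟶ Y)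
    (hf : WeakHomotopyEquiv f) :
    ∃ (P : SSet.{u}) (j : X ⟶ P) (q : P ⟶ Y) (ρ : P ⟶ X) (D : P ⊗ Δ[1] ⟶ P)
      (s : Y ⟶ P) (E : P ⊗ Δ[1] ⟶ P), Fibration q ∧ j ≫ q = f ∧ j ≫ ρ = 𝟙 X ∧
      ι₀ ≫ D = ρ ≫ j ∧ ι₁ ≫ D = 𝟙 P ∧ j ▷ Δ[1] ≫ D = fst _ _ ≫ j ∧
      s ≫ q = 𝟙 Y ∧ ι₀ ≫ E = 𝟙 P ∧ ι₁ ≫ E = q ≫ s ∧ E ≫ q = fst _ _ ≫ q := by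
  obtain ⟨P, j, q, hj, hq, fac⟩ := exists_factor f
  haveI := fibration_toUnit hX
  haveI := fibration_toUnit hY
  haveI : Fibration (toUnit P) := by
    rw [← toUnit_unique (q ≫ toUnit Y) (toUnit P)]
    infer_instance
  obtain ⟨x0, -⟩ := hX (n := 0) (i := 0)
    { app := fun n => ↾fun x => (horn0_empty 0 x.1 x.2).elim
      naturality := fun n m w => ConcreteCategory.hom_ext _ _ fun x => (horn0_empty 0 x.1 x.2).elim }
  have hP : IsKan P := isKan_of_fibration (x0 ≫ j)
  obtain ⟨ρ, hρ⟩ : ∃ ρ : P ⟶ X, j ≫ ρ = 𝟙 X := by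
    have h0 := hj (toUnit X) ((HomotopicalAlgebra.fibration_iff _).1 inferInstance)
    have sq : CommSq (𝟙 X) j (toUnit X) (toUnit _) := ⟨toUnit_unique _ _⟩
    exact ⟨sq.lift, sq.fac_left⟩
  obtain ⟨D, hD, hDj, -⟩ := lift_pp_left j hj (∂Δ[1] : (Δ[1] : SSet.{u}).Subcomplex).ι (toUnit P)
    (glue (ρ ≫ j) (𝟙 P)) (fst _ _ ≫ j) (toUnit _) (by
      refine sset_ext fun n x => ?_
      obtain ⟨z, t, ht⟩ := x
      rcases glue_app (ρ ≫ j) (𝟙 P) n (j.app n z) t ht with ⟨-, -, h⟩ | ⟨-, -, h⟩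
      · refine h.trans ?_
        exact congrArg (j.app n) (app_congr hρ n z)
      · exact h) (toUnit_unique _ _) (toUnit_unique _ _)
  have hD0 : ι₀ ≫ D = ρ ≫ j := sset_ext fun n z =>
    (app_congr hD n (z, ⟨_, const_mem 0 n⟩)).trans (glue_app_zero (ρ ≫ j) (𝟙 P) n z)
  have hD1 : ι₁ ≫ D = 𝟙 P := sset_ext fun n z =>
    (app_congr hD n (z, ⟨_, const_mem 1 n⟩)).trans (glue_app_one (ρ ≫ j) (𝟙 P) n z)
  have hjinj : ∀ (K : SSet.{u}) [Fibration (toUnit K)] (g g' : P ⟶ K),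
      SHomotopic (j ≫ g) (j ≫ g') → SHomotopic g g' := by
    intro K _ g g' h
    have hDs : SHomotopic (ρ ≫ j) (𝟙 P) := (shom_iff _ _).2 ⟨D, hD0, hD1⟩
    have a := shom_comp hDs g
    have b := shom_comp hDs g'
    have c := shom_precomp ρ h
    rw [Category.assoc, Category.id_comp] at a b
    exact shom_trans (shom_symm a) (shom_trans c b)
  obtain ⟨s0, hs0⟩ : ∃ s0 : Y ⟶ P, SHomotopic (q ≫ s0) (𝟙 P) := by
    obtain ⟨s0, h⟩ := cls_surj (hf P hP).2 j
    refine ⟨s0, hjinj P _ _ ?_⟩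
    rw [← Category.assoc, fac, Category.comp_id]
    exact h
  have hs1 : SHomotopic (𝟙 Y) (s0 ≫ q) := by
    refine cls_inj (hf Y hY).1 _ _ ?_
    have := shom_precomp j (shom_comp hs0 q)
    rw [Category.id_comp, Category.assoc, ← Category.assoc, fac] at this
    rw [Category.comp_id]
    exact shom_symm this
  obtain ⟨W, hW0, hW1⟩ := (shom_iff _ _).1 hs1
  obtain ⟨S, hS1, hSq⟩ := hlp q s0 W hW1
  have hsq : (ι₀ ≫ S) ≫ q = 𝟙 Y := by rw [Category.assoc, hSq, hW0]
  have hss : SHomotopic (ι₀ ≫ S) s0 := (shom_iff _ _).2 ⟨S, rfl, hS1⟩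
  generalize ι₀ ≫ S = s at hsq hss
  have hH : SHomotopic (𝟙 P) (q ≫ s) :=
    shom_trans (shom_symm hs0) (shom_symm (shom_precomp q hss))
  obtain ⟨H, hH0, hH1⟩ := (shom_iff _ _).1 hH
  obtain ⟨E, hE0, hE1, hEq⟩ := euclid q H (H ≫ q ≫ s) (q ≫ s) hH1
    (by rw [← Category.assoc, hH1, Category.assoc, ← Category.assoc s, hsq, Category.id_comp])
    (by rw [Category.assoc, Category.assoc, hsq, Category.comp_id])
  refine ⟨P, j, q, ρ, D, s, E, hq, fac, hρ, hD0, hD1, hDj, hsq, hE0.trans hH0, ?_, ?_⟩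
  · rw [hE1, ← Category.assoc, hH0, Category.id_comp]
  · rw [hEq, ← Category.assoc ι₀, hH0, Category.id_comp]

/-- Relative lifting up to homotopy along a weak equivalence. -/
lemma rel_lift {X Y : SSet.{u}} (hX : IsKan X) (hY : IsKan Y) (f : X ⟶ Y)
    (hf : WeakHomotopyEquiv f) {A B : SSet.{u}} (i : A ⟶ B) [Mono i] (a : A ⟶ X) (c : B ⟶ Y)
    (h : i ≫ c = a ≫ f) :
    ∃ (b : B ⟶ X) (G : B ⊗ Δ[1] ⟶ Y), i ≫ b = a ∧ ι₀ ≫ G = b ≫ f ∧ ι₁ ≫ G = c ∧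
      i ▷ Δ[1] ≫ G = fst _ _ ≫ i ≫ c := by
  obtain ⟨P, j, q, ρ, D, s, E, hq, fac, hρ, hD0, hD1, hDj, hs, hE0, hE1, hEq⟩ :=
    factor hX hY f hf
  obtain ⟨l, l1, l2, l3⟩ := hlep i q (c ≫ s) ((a ≫ j) ▷ Δ[1] ≫ E) (fst _ _ ≫ c)
    (by
      have : (ι₁ ≫ (a ≫ j) ▷ Δ[1] ≫ E : A ⟶ P) = (a ≫ j) ≫ ι₁ ≫ E := rfl
      rw [this, hE1, ← Category.assoc, h, ← fac]
      simp only [Category.assoc])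
    (by rw [Category.assoc, hs]; rfl)
    (by
      rw [Category.assoc, hEq]
      have : ((a ≫ j) ▷ Δ[1] ≫ fst P Δ[1] ≫ q) = fst _ _ ≫ a ≫ j ≫ q := rfl
      rw [this, fac, ← h]
      rfl)
  have b1 : i ≫ ι₀ ≫ l = a ≫ j := by
    have : i ≫ ι₀ ≫ l = ι₀ ≫ i ▷ Δ[1] ≫ l := rfl
    rw [this, l2]
    have : (ι₀ ≫ (a ≫ j) ▷ Δ[1] ≫ E : A ⟶ P) = (a ≫ j) ≫ ι₀ ≫ E := rfl
    rw [this, hE0, Category.comp_id]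
  have b2 : (ι₀ ≫ l) ≫ q = c := by
    rw [Category.assoc, l3]; rfl
  generalize ι₀ ≫ l = b0 at b1 b2
  refine ⟨b0 ≫ ρ, b0 ▷ Δ[1] ≫ D ≫ q, ?_, ?_, ?_, ?_⟩
  · rw [← Category.assoc, b1, Category.assoc, hρ, Category.comp_id]
  · have : (ι₀ ≫ b0 ▷ Δ[1] ≫ D ≫ q : B ⟶ Y) = b0 ≫ (ι₀ ≫ D) ≫ q := rfl
    rw [this, hD0, ← fac]
    simp only [Category.assoc]
  · have : (ι₁ ≫ b0 ▷ Δ[1] ≫ D ≫ q : B ⟶ Y) = b0 ≫ (ι₁ ≫ D) ≫ q := rfl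
    rw [this, hD1, Category.id_comp, b2]
  · rw [← Category.assoc, ← comp_whiskerRight, b1, h, ← fac, comp_whiskerRight, Category.assoc,
      ← Category.assoc (j ▷ Δ[1]), hDj]
    rfl

/-- Last face inclusion. -/
noncomputable def dl (m : ℕ) : (Δ[m] : SSet.{u}) ⟶ Δ[m + 1] := stdSimplex.δ (Fin.last (m + 1))

/-- Last degeneracy. -/
noncomputable def sl (m : ℕ) : (Δ[m + 1] : SSet.{u}) ⟶ Δ[m] := stdSimplex.σ (Fin.last m)

lemma dl_app {m : ℕ} {n : SimplexCategoryᵒᵖ} (s : (Δ[m] : SSet.{u}).obj n)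
    (k : Fin (n.unop.len + 1)) :
    stdSimplex.asOrderHom ((dl m).app n s) k = (stdSimplex.asOrderHom s k).castSucc :=
  Fin.succAbove_last_apply _

lemma sl_app {m : ℕ} {n : SimplexCategoryᵒᵖ} (s : (Δ[m + 1] : SSet.{u}).obj n)
    (k : Fin (n.unop.len + 1)) :
    stdSimplex.asOrderHom ((sl m).app n s) k
      = Fin.predAbove (Fin.last m) (stdSimplex.asOrderHom s k) := rfl

lemma sl_dl {m : ℕ} {n : SimplexCategoryᵒᵖ} (s : (Δ[m] : SSet.{u}).obj n) :
    (sl m).app n ((dl m).app n s) = s := by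
  refine stdSimplex_ext _ _ fun k => ?_
  rw [sl_app, dl_app]
  simp

/-- A simplex missing the last vertex. -/
def Miss {m : ℕ} {n : SimplexCategoryᵒᵖ} (w : (Δ[m + 1] : SSet.{u}).obj n) : Prop :=
  ∀ k, stdSimplex.asOrderHom w k ≠ Fin.last (m + 1)

lemma dl_miss {m : ℕ} {n : SimplexCategoryᵒᵖ} (s : (Δ[m] : SSet.{u}).obj n) :
    Miss ((dl m).app n s) := by
  intro k
  rw [dl_app]
  exact (Fin.castSucc_lt_last _).ne

lemma Miss.map {m : ℕ} {n n' : SimplexCategoryᵒᵖ} {w : (Δ[m + 1] : SSet.{u}).obj n}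
    (h : Miss w) (φ : n ⟶ n') : Miss ((Δ[m + 1] : SSet.{u}).map φ w) := fun _ => h _

lemma dl_sl {m : ℕ} {n : SimplexCategoryᵒᵖ} {w : (Δ[m + 1] : SSet.{u}).obj n} (h : Miss w) :
    (dl m).app n ((sl m).app n w) = w := by
  refine stdSimplex_ext _ _ fun k => ?_
  rw [dl_app, sl_app]
  obtain ⟨a, ha⟩ := Fin.exists_castSucc_eq.2 (h k)
  rw [← ha]
  simp

lemma mem_horn_last {m : ℕ} {n : SimplexCategoryᵒᵖ} (w : (Δ[m + 1] : SSet.{u}).obj n) :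
    w ∈ (Λ[m + 1, Fin.last (m + 1)] : (Δ[m + 1] : SSet.{u}).Subcomplex).obj n ↔
      ∃ a : Fin (m + 1), ∀ k, stdSimplex.asOrderHom w k ≠ a.castSucc := by
  rw [mem_horn_iff, Ne, Set.eq_univ_iff_forall]
  push Not
  constructor
  · rintro ⟨b, hb⟩
    rw [Set.mem_union, not_or] at hb
    obtain ⟨a, rfl⟩ := Fin.exists_castSucc_eq.2 hb.2
    exact ⟨a, fun k hk => hb.1 ⟨k, hk⟩⟩
  · rintro ⟨a, ha⟩
    refine ⟨a.castSucc, ?_⟩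
    rw [Set.mem_union, not_or]
    exact ⟨fun ⟨k, hk⟩ => ha k hk, (Fin.castSucc_lt_last _).ne⟩

lemma mem_bdry {m : ℕ} {n : SimplexCategoryᵒᵖ} (w : (Δ[m] : SSet.{u}).obj n) :
    w ∈ (∂Δ[m] : (Δ[m] : SSet.{u}).Subcomplex).obj n ↔
      ∃ a : Fin (m + 1), ∀ k, stdSimplex.asOrderHom w k ≠ a := by
  show (¬ Function.Surjective _) ↔ _
  rw [Function.Surjective]
  push Not
  rfl

lemma horn_bdry {m : ℕ} {n : SimplexCategoryᵒᵖ} {w : (Δ[m + 1] : SSet.{u}).obj n}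
    (h : w ∈ (Λ[m + 1, Fin.last (m + 1)] : (Δ[m + 1] : SSet.{u}).Subcomplex).obj n) :
    w ∈ (∂Δ[m + 1] : (Δ[m + 1] : SSet.{u}).Subcomplex).obj n := by
  rw [mem_horn_last] at h
  rw [mem_bdry]
  obtain ⟨a, ha⟩ := h
  exact ⟨_, ha⟩

lemma miss_bdry {m : ℕ} {n : SimplexCategoryᵒᵖ} {w : (Δ[m + 1] : SSet.{u}).obj n}
    (h : Miss w) : w ∈ (∂Δ[m + 1] : (Δ[m + 1] : SSet.{u}).Subcomplex).obj n := by
  rw [mem_bdry]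
  exact ⟨_, h⟩

lemma bdry_miss {m : ℕ} {n : SimplexCategoryᵒᵖ} {w : (Δ[m + 1] : SSet.{u}).obj n}
    (h : w ∈ (∂Δ[m + 1] : (Δ[m + 1] : SSet.{u}).Subcomplex).obj n)
    (h' : w ∉ (Λ[m + 1, Fin.last (m + 1)] : (Δ[m + 1] : SSet.{u}).Subcomplex).obj n) :
    Miss w := by
  rw [mem_bdry] at h
  rw [mem_horn_last] at h'
  obtain ⟨a, ha⟩ := h
  by_cases e : a = Fin.last (m + 1)
  · subst e; exact ha
  · obtain ⟨b, rfl⟩ := Fin.exists_castSucc_eq.2 e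
    exact absurd ⟨b, ha⟩ h'

lemma dl_horn_iff {m : ℕ} {n : SimplexCategoryᵒᵖ} (s : (Δ[m] : SSet.{u}).obj n) :
    (dl m).app n s ∈ (Λ[m + 1, Fin.last (m + 1)] : (Δ[m + 1] : SSet.{u}).Subcomplex).obj n ↔
      s ∈ (∂Δ[m] : (Δ[m] : SSet.{u}).Subcomplex).obj n := by
  rw [mem_bdry, mem_horn_last]
  simp only [dl_app, Ne, Fin.castSucc_inj]

lemma sl_bdry {m : ℕ} {n : SimplexCategoryᵒᵖ} {w : (Δ[m + 1] : SSet.{u}).obj n} (hw : Miss w)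
    (h : w ∈ (Λ[m + 1, Fin.last (m + 1)] : (Δ[m + 1] : SSet.{u}).Subcomplex).obj n) :
    (sl m).app n w ∈ (∂Δ[m] : (Δ[m] : SSet.{u}).Subcomplex).obj n := by
  rw [← dl_horn_iff, dl_sl hw]
  exact h

open Classical in
/-- Auxiliary gluing map. -/
noncomputable def gl2 {m : ℕ} {Y : SSet.{u}} (k0 : Δ[m + 1] ⟶ Y) (G : Δ[m] ⊗ Δ[1] ⟶ Y)
    (hG : ∀ n (s : (Δ[m] : SSet.{u}).obj n) t,
      s ∈ (∂Δ[m] : (Δ[m] : SSet.{u}).Subcomplex).obj n →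
      G.app n (s, t) = k0.app n ((dl m).app n s)) :
    (∂Δ[m + 1] : SSet.{u}) ⊗ Δ[1] ⟶ Y where
  app n := ↾fun z =>
    if z.1.1 ∈ (Λ[m + 1, Fin.last (m + 1)] : (Δ[m + 1] : SSet.{u}).Subcomplex).obj n then
      k0.app n z.1.1 else G.app n ((sl m).app n z.1.1, z.2)
  naturality n n' φ := by
    refine ConcreteCategory.hom_ext _ _ fun z => ?_
    obtain ⟨⟨w, hw⟩, t⟩ := z
    show (if (Δ[m + 1] : SSet.{u}).map φ w ∈
        (Λ[m + 1, Fin.last (m + 1)] : (Δ[m + 1] : SSet.{u}).Subcomplex).obj n' then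
          k0.app n' ((Δ[m + 1] : SSet.{u}).map φ w)
        else G.app n' ((sl m).app n' ((Δ[m + 1] : SSet.{u}).map φ w),
          (Δ[1] : SSet.{u}).map φ t))
      = Y.map φ (if w ∈ (Λ[m + 1, Fin.last (m + 1)] : (Δ[m + 1] : SSet.{u}).Subcomplex).obj n then
          k0.app n w else G.app n ((sl m).app n w, t))
    have e1 : k0.app n' ((Δ[m + 1] : SSet.{u}).map φ w) = Y.map φ (k0.app n w) :=
      NatTrans.naturality_apply k0 φ w
    have e0 : ∀ z : (Δ[m] ⊗ Δ[1] : SSet.{u}).obj n,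
        G.app n' ((Δ[m] ⊗ Δ[1] : SSet.{u}).map φ z) = Y.map φ (G.app n z) :=
      fun z => NatTrans.naturality_apply G φ z
    have e2 : G.app n' ((sl m).app n' ((Δ[m + 1] : SSet.{u}).map φ w),
          (Δ[1] : SSet.{u}).map φ t) = Y.map φ (G.app n ((sl m).app n w, t)) :=
      e0 ((sl m).app n w, t)
    by_cases h : w ∈ (Λ[m + 1, Fin.last (m + 1)] : (Δ[m + 1] : SSet.{u}).Subcomplex).obj n
    · have h' : (Δ[m + 1] : SSet.{u}).map φ w ∈
          (Λ[m + 1, Fin.last (m + 1)] : (Δ[m + 1] : SSet.{u}).Subcomplex).obj n' :=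
        (Λ[m + 1, Fin.last (m + 1)] : (Δ[m + 1] : SSet.{u}).Subcomplex).map φ h
      rw [if_pos h, if_pos h', e1]
    · have hm : Miss w := bdry_miss hw h
      rw [if_neg h]
      split_ifs with h'
      · rw [← e2, hG _ _ _ (sl_bdry (hm.map φ) h'), dl_sl (hm.map φ)]
      · exact e2

/-- The key extension property. -/
lemma core {X Y : SSet.{u}} (hX : IsKan X) (hY : IsKan Y) (f : X ⟶ Y)
    (hf : WeakHomotopyEquiv f) (m : ℕ) (a : (∂Δ[m] : SSet.{u}) ⟶ X)
    (h : (Λ[m + 1, Fin.last (m + 1)] : SSet.{u}) ⟶ Y)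
    (hah : ∀ n (s : (Δ[m] : SSet.{u}).obj n)
      (hs : s ∈ (∂Δ[m] : (Δ[m] : SSet.{u}).Subcomplex).obj n),
      f.app n (a.app n ⟨s, hs⟩) = h.app n ⟨(dl m).app n s, (dl_horn_iff s).2 hs⟩) :
    ∃ (b : Δ[m] ⟶ X) (k : Δ[m + 1] ⟶ Y), (∂Δ[m] : (Δ[m] : SSet.{u}).Subcomplex).ι ≫ b = a ∧
      (Λ[m + 1, Fin.last (m + 1)] : (Δ[m + 1] : SSet.{u}).Subcomplex).ι ≫ k = h ∧
      dl m ≫ k = b ≫ f := by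
  have := fibration_toUnit hY
  obtain ⟨k0, hk0⟩ := hY h
  have hk0' : ∀ n w hw, k0.app n w = h.app n ⟨w, hw⟩ := fun n w hw =>
    (app_congr hk0 n ⟨w, hw⟩).symm
  obtain ⟨b, G, hb, hG0, hG1, hG⟩ := rel_lift hX hY f hf
    (∂Δ[m] : (Δ[m] : SSet.{u}).Subcomplex).ι a (dl m ≫ k0) (by
      refine sset_ext fun n x => ?_
      obtain ⟨s, hs⟩ := x
      exact (hk0' n _ ((dl_horn_iff s).2 hs)).trans (hah n s hs).symm)
  have hG' : ∀ n (s : (Δ[m] : SSet.{u}).obj n) t,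
      s ∈ (∂Δ[m] : (Δ[m] : SSet.{u}).Subcomplex).obj n →
      G.app n (s, t) = k0.app n ((dl m).app n s) := fun n s t hs =>
    app_congr hG n (⟨s, hs⟩, t)
  have p1 : ∀ n w hw t, w ∈ (Λ[m + 1, Fin.last (m + 1)] :
      (Δ[m + 1] : SSet.{u}).Subcomplex).obj n → (gl2 k0 G hG').app n (⟨w, hw⟩, t) = k0.app n w :=
    fun n w hw t h => if_pos h
  have p2 : ∀ n w hw t, w ∉ (Λ[m + 1, Fin.last (m + 1)] :
      (Δ[m + 1] : SSet.{u}).Subcomplex).obj n →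
      (gl2 k0 G hG').app n (⟨w, hw⟩, t) = G.app n ((sl m).app n w, t) :=
    fun n w hw t h => if_neg h
  obtain ⟨l, l1, l2, -⟩ := hlep (∂Δ[m + 1] : (Δ[m + 1] : SSet.{u}).Subcomplex).ι (toUnit Y)
    k0 (gl2 k0 G hG') (toUnit _) (by
      refine sset_ext fun n x => ?_
      obtain ⟨w, hw⟩ := x
      by_cases hL : w ∈ (Λ[m + 1, Fin.last (m + 1)] : (Δ[m + 1] : SSet.{u}).Subcomplex).obj n
      · exact (p1 n w hw (stdSimplex.const 1 1 n) hL).symm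
      · refine Eq.trans ?_ (p2 n w hw (stdSimplex.const 1 1 n) hL).symm
        refine Eq.trans ?_ (app_congr hG1 n ((sl m).app n w)).symm
        exact congrArg (k0.app n) (dl_sl (bdry_miss hw hL)).symm)
    (toUnit_unique _ _) (toUnit_unique _ _)
  refine ⟨b, ι₀ ≫ l, hb, ?_, ?_⟩
  · refine sset_ext fun n x => ?_
    obtain ⟨w, hw⟩ := x
    refine (app_congr l2 n (⟨w, horn_bdry hw⟩, stdSimplex.const 1 0 n)).trans ?_
    exact (p1 n w _ _ hw).trans (hk0' n w hw)
  · refine sset_ext fun n s => ?_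
    refine (app_congr l2 n (⟨(dl m).app n s, miss_bdry (dl_miss s)⟩,
      stdSimplex.const 1 0 n)).trans ?_
    refine Eq.trans ?_ (app_congr hG0 n s)
    by_cases hs : (dl m).app n s ∈
      (Λ[m + 1, Fin.last (m + 1)] : (Δ[m + 1] : SSet.{u}).Subcomplex).obj n
    · exact (p1 n _ _ _ hs).trans (hG' n s _ ((dl_horn_iff s).1 hs)).symm
    · refine (p2 n _ _ _ hs).trans ?_
      rw [sl_dl]
      rfl

/-- Last vertex of a simplex of the standard simplex. -/
def lv {k : ℕ} {n : SimplexCategoryᵒᵖ} (w : (Δ[k] : SSet.{u}).obj n) : Fin (k + 1) :=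
  stdSimplex.asOrderHom w (Fin.last _)

lemma le_lv {k : ℕ} {n : SimplexCategoryᵒᵖ} (w : (Δ[k] : SSet.{u}).obj n)
    (a : Fin (n.unop.len + 1)) : stdSimplex.asOrderHom w a ≤ lv w :=
  (stdSimplex.asOrderHom w).monotone (Fin.le_last _)

lemma lv_map_le {k : ℕ} {n n' : SimplexCategoryᵒᵖ} (φ : n ⟶ n') (w : (Δ[k] : SSet.{u}).obj n) :
    lv ((Δ[k] : SSet.{u}).map φ w) ≤ lv w := le_lv w _

/-- Transition maps. -/
abbrev tr {k : ℕ} (S : Fin (k + 1) ⥤ SSet.{u}) {a b : Fin (k + 1)} (h : a ≤ b) :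
    S.obj a ⟶ S.obj b := S.map (homOfLE h)

lemma tr_tr {k : ℕ} (S : Fin (k + 1) ⥤ SSet.{u}) {a b c : Fin (k + 1)} (h : a ≤ b) (h' : b ≤ c)
    (n : SimplexCategoryᵒᵖ) (x : (S.obj a).obj n) :
    (tr S h').app n ((tr S h).app n x) = (tr S (h.trans h')).app n x := by
  have : tr S h ≫ tr S h' = tr S (h.trans h') := by
    rw [tr, tr, ← S.map_comp]; rfl
  exact app_congr this n x

lemma tr_bij {k : ℕ} (S : Fin (k + 1) ⥤ SSet.{u}) {a b : Fin (k + 1)} (h : a ≤ b) (e : a = b)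
    (n : SimplexCategoryᵒᵖ) : Function.Bijective ((tr S h).app n) := by
  subst e
  have : tr S h = 𝟙 _ := S.map_id _
  rw [this]
  exact Function.bijective_id

/-- Pushing a compatible family to a single object. -/
def push {k : ℕ} (S : Fin (k + 1) ⥤ SSet.{u}) (A : (Δ[k] : SSet.{u}).Subcomplex)
    (y : ∀ n (w : (Δ[k] : SSet.{u}).obj n), w ∈ A.obj n → (S.obj (lv w)).obj n)
    (hy : ∀ n n' (φ : n ⟶ n') (w : (Δ[k] : SSet.{u}).obj n) (hw : w ∈ A.obj n)
      (hw' : (Δ[k] : SSet.{u}).map φ w ∈ A.obj n'),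
      (tr S (lv_map_le φ w)).app n' (y n' _ hw') = (S.obj (lv w)).map φ (y n w hw))
    {T : SSet.{u}} (g : T ⟶ Δ[k]) (hg : ∀ n z, g.app n z ∈ A.obj n) (j : Fin (k + 1))
    (hj : ∀ n z, lv (g.app n z) ≤ j) : T ⟶ S.obj j where
  app n := ↾fun z => (tr S (hj n z)).app n (y n _ (hg n z))
  naturality n n' φ := by
    refine ConcreteCategory.hom_ext _ _ fun z => ?_
    show (tr S (hj n' (T.map φ z))).app n' (y n' (g.app n' (T.map φ z)) (hg n' (T.map φ z)))
      = (S.obj j).map φ ((tr S (hj n z)).app n (y n _ (hg n z)))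
    rw [← NatTrans.naturality_apply]
    have e : g.app n' (T.map φ z) = (Δ[k] : SSet.{u}).map φ (g.app n z) :=
      NatTrans.naturality_apply g φ z
    have key : ∀ (w' : (Δ[k] : SSet.{u}).obj n') (_ : w' = (Δ[k] : SSet.{u}).map φ (g.app n z))
        (hA : w' ∈ A.obj n') (hB : lv w' ≤ j), (tr S hB).app n' (y n' w' hA)
          = (tr S (hj n z)).app n' ((S.obj (lv (g.app n z))).map φ (y n _ (hg n z))) := by
      rintro w' rfl hA hB
      rw [← hy n n' φ _ (hg n z) hA, tr_tr]
    exact key _ e _ _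

lemma lv_of_hit {k : ℕ} {n : SimplexCategoryᵒᵖ} (w : (Δ[k] : SSet.{u}).obj n)
    (a : Fin (n.unop.len + 1)) (h : stdSimplex.asOrderHom w a = Fin.last k) :
    lv w = Fin.last k := Fin.last_le_iff.1 (h ▸ le_lv w a)

lemma ext1 {k : ℕ} (S : Fin (k + 1) ⥤ SSet.{u}) (hS : ∀ j, IsKan (S.obj j)) (i : Fin (k + 1))
    (hi : i ≠ Fin.last k)
    (y : ∀ n (w : (Δ[k] : SSet.{u}).obj n),
      w ∈ (Λ[k, i] : (Δ[k] : SSet.{u}).Subcomplex).obj n → (S.obj (lv w)).obj n)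
    (hy : ∀ n n' (φ : n ⟶ n') (w : (Δ[k] : SSet.{u}).obj n)
      (hw : w ∈ (Λ[k, i] : (Δ[k] : SSet.{u}).Subcomplex).obj n)
      (hw' : (Δ[k] : SSet.{u}).map φ w ∈ (Λ[k, i] : (Δ[k] : SSet.{u}).Subcomplex).obj n'),
      (tr S (lv_map_le φ w)).app n' (y n' _ hw') = (S.obj (lv w)).map φ (y n w hw)) :
    ∃ x : ∀ n (w : (Δ[k] : SSet.{u}).obj n), (S.obj (lv w)).obj n,
      (∀ n n' (φ : n ⟶ n') (w : (Δ[k] : SSet.{u}).obj n),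
        (tr S (lv_map_le φ w)).app n' (x n' _) = (S.obj (lv w)).map φ (x n w)) ∧
      ∀ n w hw, x n w = y n w hw := by
  obtain ⟨K, hK⟩ := hS _ (push S _ y hy (Λ[k, i] : (Δ[k] : SSet.{u}).Subcomplex).ι
    (fun n z => z.2) (Fin.last k) (fun n z => Fin.le_last _))
  have hlast : ∀ n (w : (Δ[k] : SSet.{u}).obj n),
      w ∉ (Λ[k, i] : (Δ[k] : SSet.{u}).Subcomplex).obj n → lv w = Fin.last k := by
    intro n w hw
    rw [mem_horn_iff, not_not] at hw
    have h1 : Fin.last k ∈ Set.range (stdSimplex.asOrderHom w) ∪ {i} := by rw [hw]; trivial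
    rcases h1 with ⟨a, ha⟩ | h1
    · exact lv_of_hit w a ha
    · exact absurd h1.symm hi
  have hex : ∀ n (w : (Δ[k] : SSet.{u}).obj n), ∃ x0 : (S.obj (lv w)).obj n,
      (∀ hw, x0 = y n w hw) ∧ (tr S (Fin.le_last _)).app n x0 = K.app n w := by
    intro n w
    by_cases hw : w ∈ (Λ[k, i] : (Δ[k] : SSet.{u}).Subcomplex).obj n
    · exact ⟨y n w hw, fun _ => rfl, app_congr hK n ⟨w, hw⟩⟩
    · obtain ⟨x0, hx0⟩ := (tr_bij S (Fin.le_last _) (hlast n w hw) n).2 (K.app n w)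
      exact ⟨x0, fun h => absurd h hw, hx0⟩
  choose x hx1 hx2 using hex
  refine ⟨x, fun n n' φ w => ?_, hx1⟩
  by_cases hw : w ∈ (Λ[k, i] : (Δ[k] : SSet.{u}).Subcomplex).obj n
  · have hw' : (Δ[k] : SSet.{u}).map φ w ∈ (Λ[k, i] : (Δ[k] : SSet.{u}).Subcomplex).obj n' :=
      (Λ[k, i] : (Δ[k] : SSet.{u}).Subcomplex).map φ hw
    rw [hx1 n w hw, hx1 n' _ hw', hy]
  · apply (tr_bij S (Fin.le_last _) (hlast n w hw) n').1
    rw [tr_tr, hx2, NatTrans.naturality_apply (tr S _), hx2]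
    exact NatTrans.naturality_apply K φ w

lemma ext2 {m : ℕ} (S : Fin (m + 1 + 1) ⥤ SSet.{u}) (hS : ∀ j, IsKan (S.obj j))
    (hS' : ∀ ⦃a b⦄ (g : a ⟶ b), WeakHomotopyEquiv (S.map g))
    (y : ∀ n (w : (Δ[m + 1] : SSet.{u}).obj n),
      w ∈ (Λ[m + 1, Fin.last (m + 1)] : (Δ[m + 1] : SSet.{u}).Subcomplex).obj n →
        (S.obj (lv w)).obj n)
    (hy : ∀ n n' (φ : n ⟶ n') (w : (Δ[m + 1] : SSet.{u}).obj n)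
      (hw : w ∈ (Λ[m + 1, Fin.last (m + 1)] : (Δ[m + 1] : SSet.{u}).Subcomplex).obj n)
      (hw' : (Δ[m + 1] : SSet.{u}).map φ w ∈
        (Λ[m + 1, Fin.last (m + 1)] : (Δ[m + 1] : SSet.{u}).Subcomplex).obj n'),
      (tr S (lv_map_le φ w)).app n' (y n' _ hw') = (S.obj (lv w)).map φ (y n w hw)) :
    ∃ x : ∀ n (w : (Δ[m + 1] : SSet.{u}).obj n), (S.obj (lv w)).obj n,
      (∀ n n' (φ : n ⟶ n') (w : (Δ[m + 1] : SSet.{u}).obj n),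
        (tr S (lv_map_le φ w)).app n' (x n' _) = (S.obj (lv w)).map φ (x n w)) ∧
      ∀ n w hw, x n w = y n w hw := by
  have hmiss : ∀ n (w : (Δ[m + 1] : SSet.{u}).obj n), Miss w → lv w ≤ (Fin.last m).castSucc := by
    intro n w hw
    obtain ⟨a, ha⟩ := Fin.exists_castSucc_eq.2 (hw (Fin.last _))
    show stdSimplex.asOrderHom w _ ≤ _
    rw [← ha]
    exact Fin.castSucc_le_castSucc_iff.2 (Fin.le_last _)
  have hmiss' : ∀ n (w : (Δ[m + 1] : SSet.{u}).obj n), lv w ≤ (Fin.last m).castSucc → Miss w := by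
    intro n w hw a ha
    rw [lv_of_hit w a ha] at hw
    exact absurd (Fin.castSucc_lt_last (Fin.last m)) (not_lt.2 hw)
  obtain ⟨b, K, hb, hK, hbK⟩ := core (hS (Fin.last m).castSucc) (hS (Fin.last (m + 1)))
    (tr S (Fin.le_last _)) (hS' _) m
    (push S _ y hy ((∂Δ[m] : (Δ[m] : SSet.{u}).Subcomplex).ι ≫ dl m)
      (fun n z => (dl_horn_iff z.1).2 z.2) (Fin.last m).castSucc
      (fun n z => hmiss n _ (dl_miss z.1)))
    (push S _ y hy (Λ[m + 1, Fin.last (m + 1)] : (Δ[m + 1] : SSet.{u}).Subcomplex).ι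
      (fun n z => z.2) (Fin.last (m + 1)) (fun n z => Fin.le_last _))
    (fun n s hs => tr_tr S _ _ n _)
  have hlv : ∀ n (w : (Δ[m + 1] : SSet.{u}).obj n),
      w ∉ (Λ[m + 1, Fin.last (m + 1)] : (Δ[m + 1] : SSet.{u}).Subcomplex).obj n →
      lv w = Fin.last (m + 1) ∨ (Miss w ∧ lv w = (Fin.last m).castSucc) := by
    intro n w hw
    by_cases h : Miss w
    · refine Or.inr ⟨h, le_antisymm (hmiss n w h) ?_⟩
      rw [mem_horn_last] at hw
      push Not at hw
      obtain ⟨a, ha⟩ := hw (Fin.last m)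
      exact ha ▸ le_lv w a
    · rw [Miss] at h
      push Not at h
      obtain ⟨a, ha⟩ := h
      exact Or.inl (lv_of_hit w a ha)
  have hex : ∀ n (w : (Δ[m + 1] : SSet.{u}).obj n), ∃ x0 : (S.obj (lv w)).obj n,
      (∀ hw, x0 = y n w hw) ∧ (tr S (Fin.le_last _)).app n x0 = K.app n w ∧
      ∀ h : lv w ≤ (Fin.last m).castSucc, (tr S h).app n x0 = b.app n ((sl m).app n w) := by
    intro n w
    by_cases hw : w ∈ (Λ[m + 1, Fin.last (m + 1)] : (Δ[m + 1] : SSet.{u}).Subcomplex).obj n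
    · refine ⟨y n w hw, fun _ => rfl, (app_congr hK n ⟨w, hw⟩).symm, fun h => ?_⟩
      have hm := hmiss' n w h
      refine Eq.trans ?_ (app_congr hb n ⟨(sl m).app n w, sl_bdry hm hw⟩).symm
      have key : ∀ (w' : (Δ[m + 1] : SSet.{u}).obj n) (e : w' = w) (h1) (h2),
          (tr S h).app n (y n w hw) = (tr S h1).app n (y n w' h2) := by
        rintro w' rfl h1 h2
        rfl
      exact key _ (dl_sl hm) _ _
    · rcases hlv n w hw with h | ⟨hm, h⟩
      · obtain ⟨x0, hx0⟩ := (tr_bij S (Fin.le_last _) h n).2 (K.app n w)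
        refine ⟨x0, fun h => absurd h hw, hx0, fun h' => ?_⟩
        rw [h] at h'
        exact absurd (Fin.castSucc_lt_last (Fin.last m)) (not_lt.2 h')
      · obtain ⟨x0, hx0⟩ := (tr_bij S (hmiss n w hm) h n).2 (b.app n ((sl m).app n w))
        refine ⟨x0, fun h => absurd h hw, ?_, fun _ => hx0⟩
        rw [← tr_tr S (hmiss n w hm) (Fin.le_last _), hx0]
        refine (app_congr hbK n ((sl m).app n w)).symm.trans ?_
        exact congrArg (K.app n) (dl_sl hm)
  choose x hx1 hx2 hx3 using hex
  refine ⟨x, fun n n' φ w => ?_, hx1⟩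
  by_cases hw : w ∈ (Λ[m + 1, Fin.last (m + 1)] : (Δ[m + 1] : SSet.{u}).Subcomplex).obj n
  · have hw' : (Δ[m + 1] : SSet.{u}).map φ w ∈
        (Λ[m + 1, Fin.last (m + 1)] : (Δ[m + 1] : SSet.{u}).Subcomplex).obj n' :=
      (Λ[m + 1, Fin.last (m + 1)] : (Δ[m + 1] : SSet.{u}).Subcomplex).map φ hw
    rw [hx1 n w hw, hx1 n' _ hw', hy]
  · rcases hlv n w hw with h | ⟨hm, h⟩
    · apply (tr_bij S (Fin.le_last _) h n').1
      rw [tr_tr, hx2, NatTrans.naturality_apply (tr S _), hx2]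
      exact NatTrans.naturality_apply K φ w
    · apply (tr_bij S (hmiss n w hm) h n').1
      rw [tr_tr, hx3, NatTrans.naturality_apply (tr S _), hx3]
      exact NatTrans.naturality_apply (sl m ≫ b) φ w

lemma rn_aux {C : Type u} [SmallCategory C] (F : C ⥤ SSet.{u}) {d d' : SimplexCategory}
    (φ : d' ⟶ d) (s : RNSimplex F d) (β : ComposableArrows C d.len) (hs : s.α = β)
    (y : (F.obj (β.obj (lastV (𝟙 d)))).obj (op d)) (y' : (F.obj (β.obj (lastV φ))).obj (op d'))
    (hy : HEq y (s.x d (𝟙 d))) (hy' : HEq y' (s.x d' φ)) (hle : lastV φ ≤ lastV (𝟙 d)) :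
    (F.map (β.map (homOfLE hle))).app (op d') y' = (F.obj (β.obj (lastV (𝟙 d)))).map φ.op y := by
  subst hs
  obtain rfl := eq_of_heq hy
  obtain rfl := eq_of_heq hy'
  have h := s.compat d' d φ (𝟙 d)
  have key : ∀ (ψ : d' ⟶ d) (_ : ψ = φ) (hle' : lastV ψ ≤ lastV (𝟙 d)),
      (F.map (s.α.map (homOfLE hle'))).app (op d') (s.x d' ψ)
        = (F.obj (s.α.obj (lastV (𝟙 d)))).map φ.op (s.x d (𝟙 d)) →
      (F.map (s.α.map (homOfLE hle))).app (op d') (s.x d' φ)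
        = (F.obj (s.α.obj (lastV (𝟙 d)))).map φ.op (s.x d (𝟙 d)) := by
    rintro ψ rfl _ h
    exact h
  exact key _ (Category.comp_id φ) _ h

lemma rn_x_heq {C : Type u} [SmallCategory C] (F : C ⥤ SSet.{u}) {d d' : SimplexCategory}
    {s s' : RNSimplex F d} (h : s = s') {u u' : d' ⟶ d} (hu : u = u') :
    HEq (s.x d' u) (s'.x d' u') := by
  subst h hu; rfl

lemma rn_cast {C : Type u} [SmallCategory C] (F : C ⥤ SSet.{u}) {d d' : SimplexCategory}
    (s : RNSimplex F d) (β : ComposableArrows C d.len) (hs : s.α = β) (u : d' ⟶ d) :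
    ∃ y : (F.obj (β.obj (lastV u))).obj (op d'), HEq y (s.x d' u) := by
  subst hs
  exact ⟨_, HEq.rfl⟩

lemma main_lift {C : Type u} [SmallCategory C] (F : C ⥤ SSet.{u})
    (hKan : ∀ c : C, IsKan (F.obj c))
    (hW : ∀ ⦃a b : C⦄ (g : a ⟶ b), WeakHomotopyEquiv (F.map g))
    {k : ℕ} (i : Fin (k + 1)) (hk : 1 ≤ k) (t : (Λ[k, i] : SSet.{u}) ⟶ RelNerve F)
    (b : Δ[k] ⟶ nerve C) (hb : t ≫ relNerveProj F = Λ[k, i].ι ≫ b) :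
    ∃ l : Δ[k] ⟶ RelNerve F, Λ[k, i].ι ≫ l = t ∧ l ≫ relNerveProj F = b := by
  obtain ⟨α, rfl⟩ : ∃ α : ComposableArrows C k,
      b = SSet.yonedaEquiv.symm (show (nerve C).obj (op ⦋k⦌) from α) :=
    ⟨SSet.yonedaEquiv b, (Equiv.symm_apply_apply _ _).symm⟩
  have hα : ∀ n (w : (Δ[k] : SSet.{u}).obj n)
      (hw : w ∈ (Λ[k, i] : (Δ[k] : SSet.{u}).Subcomplex).obj n),
      (t.app n ⟨w, hw⟩).α = (nerve C).map (stdSimplex.objEquiv w).op α :=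
    fun n w hw => app_congr hb n ⟨w, hw⟩
  have hy0 : ∀ n (w : (Δ[k] : SSet.{u}).obj n)
      (hw : w ∈ (Λ[k, i] : (Δ[k] : SSet.{u}).Subcomplex).obj n),
      ∃ y : (F.obj (α.obj (lv w))).obj n,
        HEq y ((t.app n ⟨w, hw⟩).x n.unop (𝟙 _)) :=
    fun n w hw => rn_cast F (t.app n ⟨w, hw⟩) _ (hα n w hw) (𝟙 _)
  choose y hy using hy0
  have hnat : ∀ n n' (φ : n ⟶ n') (w : (Δ[k] : SSet.{u}).obj n)
      (hw : w ∈ (Λ[k, i] : (Δ[k] : SSet.{u}).Subcomplex).obj n)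
      (hw' : (Δ[k] : SSet.{u}).map φ w ∈ (Λ[k, i] : (Δ[k] : SSet.{u}).Subcomplex).obj n'),
      HEq (y n' _ hw') ((t.app n ⟨w, hw⟩).x n'.unop φ.unop) := by
    intro n n' φ w hw hw'
    refine (hy _ _ hw').trans ?_
    have e : t.app n' ⟨(Δ[k] : SSet.{u}).map φ w, hw'⟩ = (RelNerve F).map φ (t.app n ⟨w, hw⟩) :=
      NatTrans.naturality_apply t φ ⟨w, hw⟩
    refine (rn_x_heq F e rfl).trans ?_
    exact rn_x_heq F rfl (Category.id_comp _)
  have hc : ∀ n n' (φ : n ⟶ n') (w : (Δ[k] : SSet.{u}).obj n)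
      (hw : w ∈ (Λ[k, i] : (Δ[k] : SSet.{u}).Subcomplex).obj n)
      (hw' : (Δ[k] : SSet.{u}).map φ w ∈ (Λ[k, i] : (Δ[k] : SSet.{u}).Subcomplex).obj n'),
      (tr (α ⋙ F) (lv_map_le φ w)).app n' (y n' _ hw')
        = ((α ⋙ F).obj (lv w)).map φ (y n w hw) := by
    intro n n' φ w hw hw'
    exact rn_aux F φ.unop (t.app n ⟨w, hw⟩) _ (hα n w hw) (y n w hw) (y n' _ hw')
      (hy n w hw) (hnat n n' φ w hw hw') (Fin.le_last _)
  obtain ⟨x, hx, hxy⟩ : ∃ x : ∀ n (w : (Δ[k] : SSet.{u}).obj n),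
      ((α ⋙ F).obj (lv w)).obj n,
      (∀ n n' (φ : n ⟶ n') (w : (Δ[k] : SSet.{u}).obj n),
        (tr (α ⋙ F) (lv_map_le φ w)).app n' (x n' _)
          = ((α ⋙ F).obj (lv w)).map φ (x n w)) ∧
      ∀ n w hw, x n w = y n w hw := by
    by_cases hi : i = Fin.last k
    · obtain _ | m := k
      · omega
      · subst hi
        exact ext2 (α ⋙ F) (fun j => hKan _) (fun a b g => hW _) y hc
    · exact ext1 (α ⋙ F) (fun j => hKan _) i hi y hc
  let X : RNSimplex F ⦋k⦌ :=
    { α := α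
      x := fun d u => x (op d) (stdSimplex.objEquiv.symm u)
      compat := fun d d' v u' => hx (op d') (op d) v.op (stdSimplex.objEquiv.symm u') }
  refine ⟨SSet.yonedaEquiv.symm (show (RelNerve F).obj (op ⦋k⦌) from X), ?_, ?_⟩
  · refine sset_ext fun n z => ?_
    obtain ⟨w, hw⟩ := z
    refine RNSimplex.ext' (hα n w hw).symm fun d v => ?_
    have hw' : (Δ[k] : SSet.{u}).map v.op w ∈
        (Λ[k, i] : (Δ[k] : SSet.{u}).Subcomplex).obj (op d) :=
      (Λ[k, i] : (Δ[k] : SSet.{u}).Subcomplex).map v.op hw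
    refine HEq.trans (heq_of_eq ?_) (hnat n (op d) v.op w hw hw')
    exact hxy (op d) _ hw'
  · rfl

end HomotopyPart

/-- **Statement 8.** The projection `r_C^* F ⟶ N C` is a Kan fibration. -/
theorem relNerveProj_kanFibration {C : Type u} [SmallCategory C] (F : C ⥤ SSet.{u})
    (hKan : ∀ c : C, IsKan (F.obj c))
    (hW : ∀ ⦃a b : C⦄ (g : a ⟶ b), WeakHomotopyEquiv (F.map g)) :
    KanFibration (relNerveProj F) := by
  intro k i hk
  refine ⟨fun {t b} sq => ?_⟩
  obtain ⟨l, h1, h2⟩ := main_lift F hKan hW i hk t b sq.w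
  exact ⟨⟨{ l := l, fac_left := h1, fac_right := h2 }⟩⟩

end Paper
end
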